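/- Fix q ∈ (0,1/2) and a > 0 with a·c₀ ≥ 2. There exist constants N₀ and C > 0, independent of ε, such that for every ε ∈ (0,1] with aε < q and every integer N ≥ N₀ the following holds. Let X_0 < … < X_N be the coarse Bakhvalov mesh, let y^H be the unique solution of the nonlinear discrete scheme on this coarse mesh, and let ŷ : [0,1] → ℝ be its continuous piecewise linear interpolant. Let n = N², let x_0 < … < x_n be the fine Bakhvalov mesh with the same parameters a, q, and let y^h be the unique solution of the linear fine-mesh scheme −ε² y_{x̄x̂,i} + f_u(x_i, ŷ(x_i)) y_i = f_u(x_i, ŷ(x_i)) ŷ(x_i) − f(x_i, ŷ(x_i)), i = 1,…,n−1, y_0 = y_n = 0. Then the continuous piecewise linear interpolant u^I_{h,H} of y^h on the fine mesh satisfies max_{x∈[0,1]} |u^I_{h,H}(x) − u(x)| ≤ C N^{−4}, where u is the solution of the continuous problem. -/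

import Mathlib

open Set Real

noncomputable section

/-- first partial derivative of `f(x,u)` with respect to `u` -/
def pderiv1 (f : ℝ → ℝ → ℝ) (x y : ℝ) : ℝ := deriv (fun z => f x z) y

/-- second partial derivative of `f(x,u)` with respect to `u` -/
def pderiv2 (f : ℝ → ℝ → ℝ) (x y : ℝ) : ℝ :=
  deriv (fun z => deriv (fun w => f x w) z) y

/-- `f` is four times continuously differentiable on `[0,1] × ℝ`. -/
def SmoothF (f : ℝ → ℝ → ℝ) : Prop :=
  ContDiffOn ℝ 4 (fun p : ℝ × ℝ => f p.1 p.2) ((Icc (0:ℝ) 1) ×ˢ (univ : Set ℝ))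

/-- the stability condition `f_u(x,u) ≥ c₀² > 0` on `[0,1] × ℝ` -/
def LowerF (f : ℝ → ℝ → ℝ) (c₀ : ℝ) : Prop :=
  ∀ x ∈ Icc (0:ℝ) 1, ∀ y : ℝ, c₀ ^ 2 ≤ pderiv1 f x y

/-- `u` is a C⁴-solution of the semilinear BVP `-ε²u'' + f(x,u) = 0`, `u(0)=u(1)=0`. -/
def IsSolution (f : ℝ → ℝ → ℝ) (ε : ℝ) (u : ℝ → ℝ) : Prop :=
  ContDiffOn ℝ 4 u (Icc (0:ℝ) 1) ∧
  (∀ x ∈ Ioo (0:ℝ) 1,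
    -ε ^ 2 * iteratedDerivWithin 2 u (Icc (0:ℝ) 1) x + f x (u x) = 0) ∧
  u 0 = 0 ∧ u 1 = 0

/-- the constant `l = c₀⁻² · max_{[0,1]} |f(x,0)|` -/
def lconst (f : ℝ → ℝ → ℝ) (c₀ : ℝ) : ℝ :=
  c₀ ^ (-2 : ℤ) * sSup ((fun x => |f x 0|) '' Icc (0:ℝ) 1)

/-- the constant `θ = max { |f_uu(x,ξ)| : x ∈ [0,1], |ξ| ≤ l + 2ρ }` -/
def thconst (f : ℝ → ℝ → ℝ) (c₀ ρ : ℝ) : ℝ :=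
  sSup ((fun p : ℝ × ℝ => |pderiv2 f p.1 p.2|) ''
    ((Icc (0:ℝ) 1) ×ˢ (Icc (-(lconst f c₀ + 2*ρ)) (lconst f c₀ + 2*ρ))))

/-- discrete second difference `y_{x̄x̂,i}` on a nonuniform mesh `x` (for `1 ≤ i`),
using `ℏ_i = (h_i + h_{i+1})/2 = (x_{i+1} - x_{i-1})/2`. -/
def ddiff (x y : ℕ → ℝ) (i : ℕ) : ℝ :=
  2 / (x (i+1) - x (i-1)) *
    ((y (i+1) - y i) / (x (i+1) - x i) - (y i - y (i-1)) / (x i - x (i-1)))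

/-- Shishkin mesh generating function with transition parameter
`α = min(1/4, 2γ₀⁻¹ ε ln n)`. -/
def shishkinLam (γ₀ ε : ℝ) (n : ℕ) (t : ℝ) : ℝ :=
  let α := min (1/4) (2 * γ₀⁻¹ * ε * Real.log n)
  if t ≤ 1/4 then 4*α*t
  else if t ≤ 1/2 then α + 2*(1-2*α)*(t-1/4)
  else 1 - (if 1-t ≤ 1/4 then 4*α*(1-t) else α + 2*(1-2*α)*((1-t)-1/4))

/-- Shishkin mesh nodes `x_i = λ(i/n)` -/
def shishkinMesh (γ₀ ε : ℝ) (n i : ℕ) : ℝ := shishkinLam γ₀ ε n ((i:ℝ)/(n:ℝ))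

def bakhPhi (a ε q t : ℝ) : ℝ := a*ε*Real.log (q/(q-t))

/-- derivative of `bakhPhi` -/
def bakhPhi' (a ε q t : ℝ) : ℝ := a*ε/(q-t)

/-- `α ∈ (0,q)` is the abscissa of the contact point of the tangent line from
`(1/2,1/2)` to `φ`, i.e. `φ(α) + φ'(α)(1/2 - α) = 1/2`. -/
def IsBakhAlpha (a ε q α : ℝ) : Prop :=
  α ∈ Ioo 0 q ∧ bakhPhi a ε q α + bakhPhi' a ε q α * (1/2 - α) = 1/2

/-- Bakhvalov mesh generating function -/
def bakhLam (a ε q α t : ℝ) : ℝ :=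
  if t ≤ α then bakhPhi a ε q t
  else if t ≤ 1/2 then bakhPhi a ε q α + bakhPhi' a ε q α * (t-α)
  else 1 - (if 1-t ≤ α then bakhPhi a ε q (1-t)
            else bakhPhi a ε q α + bakhPhi' a ε q α * ((1-t)-α))

/-- Bakhvalov mesh nodes `x_i = λ(i/n)` -/
def bakhMesh (a ε q α : ℝ) (n i : ℕ) : ℝ := bakhLam a ε q α ((i:ℝ)/(n:ℝ))

def vulAlpha (a ε q : ℝ) : ℝ :=
  (q - Real.sqrt (ε*a*q*(1-2*q+2*ε*a)))/(1+2*ε*a)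

def vulMu (a ε q t : ℝ) : ℝ := a*ε*t/(q-t)

/-- derivative of `vulMu` -/
def vulMu' (a ε q t : ℝ) : ℝ := a*ε*q/(q-t)^2

/-- Vulanović mesh generating function -/
def vulLam (a ε q t : ℝ) : ℝ :=
  let α := vulAlpha a ε q
  if t ≤ α then vulMu a ε q t
  else if t ≤ 1/2 then vulMu a ε q α + vulMu' a ε q α * (t-α)
  else 1 - (if 1-t ≤ α then vulMu a ε q (1-t)
            else vulMu a ε q α + vulMu' a ε q α * ((1-t)-α))

/-- Vulanović mesh nodes `x_i = λ(i/n)` -/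
def vulMesh (a ε q : ℝ) (n i : ℕ) : ℝ := vulLam a ε q ((i:ℝ)/(n:ℝ))

/-- the three-point discrete scheme for the linear problem
`-ε² y_{x̄x̂,i} + b(x_i) y_i = g(x_i)`, `y_0 = y_n = 0` -/
def LinScheme (bc gc : ℝ → ℝ) (ε : ℝ) (x : ℕ → ℝ) (n : ℕ) (y : ℕ → ℝ) : Prop :=
  (∀ i : ℕ, 1 ≤ i → i < n →
    -ε ^ 2 * ddiff x y i + bc (x i) * y i = gc (x i)) ∧
  y 0 = 0 ∧ y n = 0

/-- the nonlinear discrete scheme `-ε² y_{x̄x̂,i} + f(x_i, y_i) = 0`, `y_0 = y_n = 0` -/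
def NonlinScheme (f : ℝ → ℝ → ℝ) (ε : ℝ) (x : ℕ → ℝ) (n : ℕ) (y : ℕ → ℝ) : Prop :=
  (∀ i : ℕ, 1 ≤ i → i < n → -ε ^ 2 * ddiff x y i + f (x i) (y i) = 0) ∧
  y 0 = 0 ∧ y n = 0

/-- `u` is a C²-solution of the continuous linear problem
`-ε²u'' + b(x)u = g(x)`, `u(0)=u(1)=0`. -/
def IsLinSolution (bc gc : ℝ → ℝ) (ε : ℝ) (u : ℝ → ℝ) : Prop :=
  ContDiffOn ℝ 2 u (Icc (0:ℝ) 1) ∧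
  (∀ x ∈ Ioo (0:ℝ) 1,
    -ε ^ 2 * iteratedDerivWithin 2 u (Icc (0:ℝ) 1) x + bc x * u x = gc x) ∧
  u 0 = 0 ∧ u 1 = 0

/-- `b(x,ε)` is three times continuously differentiable in `x` on `[0,1]`,
with these derivatives bounded uniformly in `ε ∈ [0,1]`. -/
def UnifC3 (b : ℝ → ℝ → ℝ) : Prop :=
  ∃ M : ℝ, ∀ ε ∈ Icc (0:ℝ) 1,
    ContDiffOn ℝ 3 (fun x => b x ε) (Icc (0:ℝ) 1) ∧
    ∀ j : ℕ, j ≤ 3 → ∀ x ∈ Icc (0:ℝ) 1,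
      |iteratedDerivWithin j (fun x => b x ε) (Icc (0:ℝ) 1) x| ≤ M

/-- `w` is the continuous piecewise-linear interpolant of mesh data `y`
on the mesh `x_0 < … < x_n`. -/
def IsLinInterp (x : ℕ → ℝ) (n : ℕ) (y : ℕ → ℝ) (w : ℝ → ℝ) : Prop :=
  (∀ i ≤ n, w (x i) = y i) ∧
  ∀ i < n, ∀ t ∈ Icc (x i) (x (i+1)),
    w t = y i + (y (i+1) - y i) * (t - x i) / (x (i+1) - x i)

/-- properties of the initial guess `u⁰`: of class C³, within `ρ` of the
solution `u`, and satisfying ε-uniform bounds of layer type for `j = 0, 1`. -/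
def InitGuess (c₀ ε C₀ ρ : ℝ) (u u0 : ℝ → ℝ) : Prop :=
  ContDiffOn ℝ 3 u0 (Icc (0:ℝ) 1) ∧
  (∀ x ∈ Icc (0:ℝ) 1, |u0 x - u x| ≤ ρ) ∧
  (∀ x ∈ Icc (0:ℝ) 1, |u0 x| ≤ C₀) ∧
  (∀ x ∈ Icc (0:ℝ) 1, |derivWithin u0 (Icc (0:ℝ) 1) x| ≤
    C₀ * (1 + ε⁻¹ * (Real.exp (-c₀*x/ε) + Real.exp (-c₀*(1-x)/ε))))

/-- the discrete Newton (quasilinearization) iterates on the mesh `x`: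
`y⁰_i = u⁰(x_i)` and `y^{m+1}` solves the quasilinearized discrete problem. -/
def NewtonIter (f : ℝ → ℝ → ℝ) (ε : ℝ) (x : ℕ → ℝ) (n : ℕ) (u0 : ℝ → ℝ)
    (Y : ℕ → ℕ → ℝ) : Prop :=
  (∀ i ≤ n, Y 0 i = u0 (x i)) ∧
  ∀ m : ℕ,
    (∀ i : ℕ, 1 ≤ i → i < n →
      -ε ^ 2 * ddiff x (Y (m+1)) i + pderiv1 f (x i) (Y m i) * Y (m+1) i
        = -f (x i) (Y m i) + pderiv1 f (x i) (Y m i) * Y m i) ∧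
    Y (m+1) 0 = 0 ∧ Y (m+1) n = 0

/-- weight function of the Bakhvalov mesh -/
def kap (q α t : ℝ) : ℝ := max (q - α) (max (q - t) (q - 1 + t))

theorem kap_lip (q α s t : ℝ) : |kap q α s - kap q α t| ≤ |s - t| := by
  unfold kap
  refine (abs_max_sub_max_le_max _ _ _ _).trans ?_
  refine max_le (by simp) ?_
  refine (abs_max_sub_max_le_max _ _ _ _).trans ?_
  refine max_le ?_ ?_
  · rw [show q - s - (q - t) = -(s - t) by ring, abs_neg]
  · rw [show q - 1 + s - (q - 1 + t) = s - t by ring]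

theorem kap_symm (q α t : ℝ) : kap q α (1 - t) = kap q α t := by
  unfold kap
  rw [max_comm (q - (1 - t))]
  congr 2 <;> ring

theorem kap_lower {a ε q α : ℝ} (hq : q ∈ Ioo (0:ℝ) (1/2)) (ha : 0 < a) (hε : 0 < ε)
    (hα : IsBakhAlpha a ε q α) (t : ℝ) : a * ε * (1 - 2 * q) ≤ kap q α t := by
  refine le_trans ?_ (le_max_left _ _)
  obtain ⟨⟨h0, h1⟩, h2⟩ := hα
  have hqa : 0 < q - α := by linarith
  have hphi : 0 ≤ bakhPhi a ε q α := by
    unfold bakhPhi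
    have : 0 ≤ Real.log (q / (q - α)) := by
      apply Real.log_nonneg
      rw [le_div_iff₀ hqa]; linarith
    positivity
  have h3 : bakhPhi' a ε q α * (1/2 - α) ≤ 1/2 := by linarith
  unfold bakhPhi' at h3
  rw [div_mul_eq_mul_div, div_le_iff₀ hqa] at h3
  have : 0 < a * ε := by positivity
  nlinarith

theorem kap_pos {q α : ℝ} (h : α < q) (t : ℝ) : 0 < kap q α t :=
  lt_of_lt_of_le (by linarith) (le_max_left _ _)

theorem phi_hasDeriv {a ε q t : ℝ} (hq : 0 < q) (ht : t < q) :
    HasDerivAt (bakhPhi a ε q) (a * ε / (q - t)) t := by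
  have h0 : q - t ≠ 0 := by linarith
  have h1 : HasDerivAt (fun s : ℝ => q / (q - s)) (q / (q - t) ^ 2) t := by
    have := ((hasDerivAt_id t).const_sub q).inv h0
    have := this.const_mul q
    refine HasDerivAt.congr_deriv this ?_
    simp only [id]; ring
  have h3 : q / (q - t) ≠ 0 := div_ne_zero hq.ne' h0
  have h2 := (h1.log h3).const_mul (a * ε)
  refine HasDerivAt.congr_deriv h2 ?_
  field_simp

/-- affine middle part -/
theorem lam_mid {a ε q α : ℝ} (hq : q < 1/2) (hα : IsBakhAlpha a ε q α)
    {t : ℝ} (h0 : α ≤ t) (h1 : t ≤ 1 - α) :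
    bakhLam a ε q α t = 1/2 + bakhPhi' a ε q α * (t - 1/2) := by
  obtain ⟨⟨h2, h3⟩, h4⟩ := hα
  unfold bakhLam
  split_ifs with c1 c2 c3
  · have : t = α := le_antisymm c1 h0
    subst this; linarith
  · linarith
  · have : t = 1 - α := by linarith
    subst this
    rw [show 1 - (1 - α) = α by ring]
    linarith
  · linarith

theorem lam_left {a ε q α : ℝ} {t : ℝ} (h0 : t ≤ α) :
    bakhLam a ε q α t = bakhPhi a ε q t := by
  unfold bakhLam; rw [if_pos h0]

theorem lam_right {a ε q α : ℝ} (hq : q < 1/2) (hα : IsBakhAlpha a ε q α)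
    {t : ℝ} (h0 : 1 - α ≤ t) :
    bakhLam a ε q α t = 1 - bakhPhi a ε q (1 - t) := by
  obtain ⟨⟨h2, h3⟩, h4⟩ := hα
  unfold bakhLam
  rw [if_neg (by linarith), if_neg (by linarith), if_pos (by linarith)]

theorem lam_symm {a ε q α : ℝ} (hq : q < 1/2) (hα : IsBakhAlpha a ε q α) (t : ℝ) :
    bakhLam a ε q α (1 - t) = 1 - bakhLam a ε q α t := by
  have hα' := hα
  obtain ⟨⟨h2, h3⟩, h4⟩ := hα
  rcases le_total t α with h | h
  · rw [lam_left h, lam_right hq hα' (by linarith)]; congr 2; ring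
  rcases le_total t (1 - α) with h' | h'
  · rw [lam_mid hq hα' h h', lam_mid hq hα' (by linarith) (by linarith)]; ring
  · rw [lam_right hq hα' h', lam_left (by linarith)]; ring

theorem lam_hasDeriv {a ε q α : ℝ} (hq : q ∈ Ioo (0:ℝ) (1/2))
    (hα : IsBakhAlpha a ε q α) (t : ℝ) :
    HasDerivAt (bakhLam a ε q α) (a * ε / kap q α t) t := by
  have hα' := hα
  obtain ⟨⟨h2, h3⟩, h4⟩ := hα
  obtain ⟨hq0, hq1⟩ := hq
  -- left piece
  have key1 : ∀ t ≤ α, HasDerivWithinAt (bakhLam a ε q α) (a * ε / kap q α t) (Iic α) t := by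
    intro t ht
    have hk : kap q α t = q - t := by
      unfold kap
      rw [max_eq_left (show q - 1 + t ≤ q - t by linarith), max_eq_right (by linarith)]
    rw [hk]
    exact (phi_hasDeriv hq0 (by linarith)).hasDerivWithinAt.congr
      (fun s hs => lam_left hs) (lam_left ht)
  have key2 : ∀ t, α ≤ t → t ≤ 1 - α →
      HasDerivWithinAt (bakhLam a ε q α) (a * ε / kap q α t) (Icc α (1 - α)) t := by
    intro t ht ht'
    have hk : kap q α t = q - α := by
      unfold kap
      rw [max_eq_left]
      exact max_le (by linarith) (by linarith)
    rw [hk]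
    have : HasDerivAt (fun s => 1/2 + bakhPhi' a ε q α * (s - 1/2)) (a * ε / (q - α)) t := by
      have := ((((hasDerivAt_id t).sub_const (1/2)).const_mul (bakhPhi' a ε q α)).const_add (1/2))
      simpa [bakhPhi'] using this
    exact this.hasDerivWithinAt.congr
      (fun s hs => lam_mid hq1 hα' hs.1 hs.2) (lam_mid hq1 hα' ht ht')
  have key3 : ∀ t, 1 - α ≤ t →
      HasDerivWithinAt (bakhLam a ε q α) (a * ε / kap q α t) (Ici (1 - α)) t := by
    intro t ht
    have hk : kap q α t = q - (1 - t) := by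
      unfold kap
      rw [max_eq_right (show q - t ≤ q - 1 + t by linarith), max_eq_right (by linarith)]; ring
    rw [hk]
    have h5 := (phi_hasDeriv (a := a) (ε := ε) hq0 (show 1 - t < q by linarith)).scomp t
      ((hasDerivAt_id t).const_sub 1)
    have h6 := h5.const_sub 1
    have : HasDerivAt (fun s => 1 - bakhPhi a ε q (1 - s)) (a * ε / (q - (1 - t))) t := by
      refine HasDerivAt.congr_deriv h6 ?_
      simp
    exact this.hasDerivWithinAt.congr
      (fun s hs => lam_right hq1 hα' hs) (lam_right hq1 hα' ht)
  rcases lt_trichotomy t α with h | h | h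
  · exact (key1 t h.le).hasDerivAt (Iic_mem_nhds h)
  · refine ((key1 t h.le).union (key2 t h.ge (by linarith))).hasDerivAt ?_
    rw [Iic_union_Icc_eq_Iic (by linarith)]
    exact Iic_mem_nhds (by linarith)
  rcases lt_trichotomy t (1 - α) with h' | h' | h'
  · exact (key2 t h.le h'.le).hasDerivAt (Icc_mem_nhds h h')
  · refine ((key2 t h.le h'.le).union (key3 t h'.ge)).hasDerivAt ?_
    rw [Icc_union_Ici_eq_Ici (by linarith)]
    exact Ici_mem_nhds h
  · exact (key3 t h'.le).hasDerivAt (Ici_mem_nhds h')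

theorem lam_zero {a ε q α : ℝ} (hq : 0 < q) (hα : IsBakhAlpha a ε q α) :
    bakhLam a ε q α 0 = 0 := by
  rw [lam_left hα.1.1.le]; unfold bakhPhi; simp [hq.ne']

theorem lam_one {a ε q α : ℝ} (hq : q ∈ Ioo (0:ℝ) (1/2)) (hα : IsBakhAlpha a ε q α) :
    bakhLam a ε q α 1 = 1 := by
  have := lam_symm hq.2 hα 0
  rw [lam_zero hq.1 hα] at this
  simpa using this

theorem lam_mvt {a ε q α : ℝ} (hq : q ∈ Ioo (0:ℝ) (1/2))
    (hα : IsBakhAlpha a ε q α) {s t : ℝ} (h : s < t) :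
    ∃ ξ ∈ Ioo s t, bakhLam a ε q α t - bakhLam a ε q α s = a * ε / kap q α ξ * (t - s) := by
  obtain ⟨c, hc, h1⟩ := exists_hasDerivAt_eq_slope (bakhLam a ε q α)
    (fun t => a * ε / kap q α t) h
    (fun x _ => (lam_hasDeriv hq hα x).continuousAt.continuousWithinAt)
    (fun x _ => lam_hasDeriv hq hα x)
  refine ⟨c, hc, ?_⟩
  rw [h1, div_mul_cancel₀]; linarith

theorem lam_strictMono {a ε q α : ℝ} (hq : q ∈ Ioo (0:ℝ) (1/2)) (ha : 0 < a) (hε : 0 < ε)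
    (hα : IsBakhAlpha a ε q α) : StrictMono (bakhLam a ε q α) := by
  intro s t h
  obtain ⟨c, hc, h1⟩ := lam_mvt hq hα h
  have := kap_pos hα.1.2 c
  have : 0 < a * ε / kap q α c * (t - s) := by
    have : 0 < t - s := by linarith
    positivity
  linarith

theorem lam_lower {a ε q α : ℝ} (hq : q ∈ Ioo (0:ℝ) (1/2)) (ha : 0 < a) (hε : 0 < ε)
    (hα : IsBakhAlpha a ε q α) {t : ℝ} :
    a * ε * Real.log (q / kap q α t) ≤ bakhLam a ε q α t := by
  have hpos := kap_pos hα.1.2 t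
  have haε : 0 < a * ε := by positivity
  rcases le_total t α with h | h
  · rw [lam_left h]
    unfold bakhPhi
    gcongr
    · exact div_pos hq.1 hpos
    · exact hq.1.le
    · linarith [hα.1.2]
    · exact (le_max_left _ _).trans (le_max_right _ _)
  · refine le_trans ?_ ((lam_strictMono hq ha hε hα).monotone h)
    rw [lam_left le_rfl]
    unfold bakhPhi
    gcongr
    · exact div_pos hq.1 hpos
    · exact hq.1.le
    · linarith [hα.1.2]
    · exact (le_max_left _ _)

theorem exp_lam {a ε q α c₀ : ℝ} (hq : q ∈ Ioo (0:ℝ) (1/2)) (ha : 0 < a) (hε : 0 < ε)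
    (hc₀ : 0 < c₀) (hac : 2 ≤ a * c₀)
    (hα : IsBakhAlpha a ε q α) {t : ℝ} (ht : t ∈ Icc (0:ℝ) 1) :
    Real.exp (-(c₀ / ε) * bakhLam a ε q α t) ≤ (kap q α t / q) ^ 2 := by
  have hpos := kap_pos hα.1.2 t
  have hle : kap q α t ≤ q := by
    unfold kap
    exact max_le (by linarith [hα.1.1]) (max_le (by linarith [ht.1]) (by linarith [ht.2]))
  have hL : 0 ≤ Real.log (q / kap q α t) := by
    apply Real.log_nonneg; rw [le_div_iff₀ hpos]; linarith
  have h1 := lam_lower hq ha hε hα (t := t)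
  have h2 : (kap q α t / q) ^ 2 = Real.exp (-(2 * Real.log (q / kap q α t))) := by
    have hq0 := hq.1
    rw [Real.exp_neg, two_mul, Real.exp_add, Real.exp_log (by positivity)]
    field_simp
  rw [h2]
  apply Real.exp_le_exp.mpr
  rw [neg_mul]
  apply neg_le_neg
  calc 2 * Real.log (q / kap q α t) ≤ a * c₀ * Real.log (q / kap q α t) := by gcongr
    _ = c₀ / ε * (a * ε * Real.log (q / kap q α t)) := by field_simp
    _ ≤ _ := by gcongr

/-- boundary layer weight -/
def Pw (c₀ ε x : ℝ) : ℝ :=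
  ε ^ 2 + (Real.exp (-(c₀ / ε) * x) + Real.exp (-(c₀ / ε) * (1 - x)))

/-- constant in `Pw ≤ C κ²` -/
def Kp (a q : ℝ) : ℝ := (a * (1 - 2 * q))⁻¹ ^ 2 + 2 * (q⁻¹) ^ 2

theorem Pw_lam {a ε q α c₀ : ℝ} (hq : q ∈ Ioo (0:ℝ) (1/2)) (ha : 0 < a) (hε : 0 < ε)
    (hc₀ : 0 < c₀) (hac : 2 ≤ a * c₀)
    (hα : IsBakhAlpha a ε q α) {t : ℝ} (ht : t ∈ Icc (0:ℝ) 1) :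
    Pw c₀ ε (bakhLam a ε q α t) ≤ Kp a q * kap q α t ^ 2 := by
  have h1 := exp_lam hq ha hε hc₀ hac hα ht
  have h2 := exp_lam hq ha hε hc₀ hac hα (t := 1 - t) ⟨by linarith [ht.2], by linarith [ht.1]⟩
  rw [lam_symm hq.2 hα, kap_symm] at h2
  have h3 := kap_lower hq ha hε hα t
  have hb : 0 < a * (1 - 2 * q) := mul_pos ha (by linarith [hq.2])
  have h4 : ε ≤ (a * (1 - 2 * q))⁻¹ * kap q α t := by
    rw [inv_mul_eq_div, le_div_iff₀ hb]; linarith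
  have h5 : ε ^ 2 ≤ ((a * (1 - 2 * q))⁻¹ * kap q α t) ^ 2 := by gcongr
  unfold Pw Kp
  calc _ ≤ ((a * (1 - 2 * q))⁻¹ * kap q α t) ^ 2 + ((kap q α t / q) ^ 2 + (kap q α t / q) ^ 2) := by
        gcongr
    _ = _ := by ring

theorem taylor_step {r r' : ℝ → ℝ} {c d x M : ℝ} {k : ℕ} (hM : 0 ≤ M)
    (hr : ∀ y ∈ Icc c d, HasDerivWithinAt r (r' y) (Icc c d) y)
    (hx : x ∈ Icc c d) (h0 : r x = 0)
    (hb : ∀ y ∈ Icc c d, |r' y| ≤ M * |y - x| ^ k) :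
    ∀ y ∈ Icc c d, |r y| ≤ M * |y - x| ^ (k + 1) := by
  intro y hy
  have hsub : uIcc x y ⊆ Icc c d := by
    rw [← uIcc_of_le (hx.1.trans hx.2)]
    apply uIcc_subset_uIcc <;> rw [uIcc_of_le (hx.1.trans hx.2)] <;> assumption
  have h1 := Convex.norm_image_sub_le_of_norm_hasDerivWithin_le (f := r) (f' := r')
    (C := M * |y - x| ^ k) (s := uIcc x y) (x := x) (y := y)
    (fun z hz => (hr z (hsub hz)).mono hsub)
    (fun z hz => by
      rw [Real.norm_eq_abs]
      refine (hb z (hsub hz)).trans ?_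
      have : |z - x| ≤ |y - x| := abs_sub_left_of_mem_uIcc hz
      gcongr)
    (convex_uIcc x y) left_mem_uIcc right_mem_uIcc
  rw [h0, sub_zero, Real.norm_eq_abs, Real.norm_eq_abs] at h1
  rw [pow_succ, ← mul_assoc]; exact h1

theorem taylor2 {g g1 g2 : ℝ → ℝ} {c d x M : ℝ} (hM : 0 ≤ M)
    (h0 : ∀ y ∈ Icc c d, HasDerivWithinAt g (g1 y) (Icc c d) y)
    (h1 : ∀ y ∈ Icc c d, HasDerivWithinAt g1 (g2 y) (Icc c d) y)
    (hx : x ∈ Icc c d) (hb : ∀ y ∈ Icc c d, |g2 y| ≤ M) :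
    ∀ y ∈ Icc c d, |g y - g x - g1 x * (y - x)| ≤ M * |y - x| ^ 2 := by
  have s1 : ∀ y ∈ Icc c d, |g1 y - g1 x| ≤ M * |y - x| ^ 1 := by
    apply taylor_step (r := fun y => g1 y - g1 x) (r' := g2) (k := 0) hM _ hx (by simp)
    · simpa using hb
    · intro y hy; exact (h1 y hy).sub_const _
  apply taylor_step (r := fun y => g y - g x - g1 x * (y - x)) (r' := fun y => g1 y - g1 x)
    (k := 1) hM _ hx (by simp) s1
  intro y hy
  have := ((h0 y hy).sub_const (g x)).sub
    (((hasDerivWithinAt_id y (Icc c d)).sub_const x).const_mul (g1 x))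
  refine HasDerivWithinAt.congr_deriv this ?_
  simp

theorem taylor4 {g g1 g2 g3 g4 : ℝ → ℝ} {c d x M : ℝ} (hM : 0 ≤ M)
    (h0 : ∀ y ∈ Icc c d, HasDerivWithinAt g (g1 y) (Icc c d) y)
    (h1 : ∀ y ∈ Icc c d, HasDerivWithinAt g1 (g2 y) (Icc c d) y)
    (h2 : ∀ y ∈ Icc c d, HasDerivWithinAt g2 (g3 y) (Icc c d) y)
    (h3 : ∀ y ∈ Icc c d, HasDerivWithinAt g3 (g4 y) (Icc c d) y)
    (hx : x ∈ Icc c d) (hb : ∀ y ∈ Icc c d, |g4 y| ≤ M) :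
    ∀ y ∈ Icc c d, |g y - g x - g1 x * (y - x) - g2 x / 2 * (y - x) ^ 2
      - g3 x / 6 * (y - x) ^ 3| ≤ M * |y - x| ^ 4 := by
  have hid : ∀ y, HasDerivWithinAt (fun y : ℝ => y - x) 1 (Icc c d) y :=
    fun y => (hasDerivWithinAt_id y (Icc c d)).sub_const x
  have s2 := taylor2 hM h2 h3 hx hb
  have s1 : ∀ y ∈ Icc c d, |g1 y - g1 x - g2 x * (y - x) - g3 x / 2 * (y - x) ^ 2|
      ≤ M * |y - x| ^ 3 := by
    apply taylor_step (r := fun y => g1 y - g1 x - g2 x * (y - x) - g3 x / 2 * (y - x) ^ 2)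
      (r' := fun y => g2 y - g2 x - g3 x * (y - x)) (k := 2) hM _ hx (by simp) s2
    intro y hy
    have := (((h1 y hy).sub_const (g1 x)).sub ((hid y).const_mul (g2 x))).sub
      (((hid y).pow 2).const_mul (g3 x / 2))
    refine HasDerivWithinAt.congr_deriv this ?_
    push_cast; ring
  apply taylor_step (r := fun y => g y - g x - g1 x * (y - x) - g2 x / 2 * (y - x) ^ 2
      - g3 x / 6 * (y - x) ^ 3)
    (r' := fun y => g1 y - g1 x - g2 x * (y - x) - g3 x / 2 * (y - x) ^ 2)
    (k := 3) hM _ hx (by simp) s1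
  intro y hy
  have := ((((h0 y hy).sub_const (g x)).sub ((hid y).const_mul (g1 x))).sub
      (((hid y).pow 2).const_mul (g2 x / 2))).sub (((hid y).pow 3).const_mul (g3 x / 6))
  refine HasDerivWithinAt.congr_deriv this ?_
  push_cast; ring

theorem ddiff_alg2 {um u up v1 h1 h2 M : ℝ} (p1 : 0 < h1) (p2 : 0 < h2)
    (e2 : |up - u - v1 * h2| ≤ M * h2 ^ 2) (e1 : |um - u + v1 * h1| ≤ M * h1 ^ 2) :
    |2 / (h1 + h2) * ((up - u) / h2 - (u - um) / h1)| ≤ 2 * M := by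
  have k2 : |(up - u - v1 * h2) / h2| ≤ M * h2 := by
    rw [abs_div, abs_of_pos p2, div_le_iff₀ p2]; linarith
  have k1 : |(um - u + v1 * h1) / h1| ≤ M * h1 := by
    rw [abs_div, abs_of_pos p1, div_le_iff₀ p1]; linarith
  have : (up - u) / h2 - (u - um) / h1 = (up - u - v1 * h2) / h2 + (um - u + v1 * h1) / h1 := by
    field_simp; ring
  rw [this, abs_mul, abs_of_pos (by positivity : 0 < 2 / (h1 + h2)), div_mul_eq_mul_div,
    div_le_iff₀ (by positivity)]
  have := abs_add_le ((up - u - v1 * h2) / h2) ((um - u + v1 * h1) / h1)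
  linarith

theorem ddiff_alg4 {um u up v1 v2 v3 h1 h2 M H : ℝ} (hM : 0 ≤ M) (p1 : 0 < h1) (p2 : 0 < h2)
    (q1 : h1 ≤ H) (q2 : h2 ≤ H)
    (e2 : |up - u - v1 * h2 - v2 / 2 * h2 ^ 2 - v3 / 6 * h2 ^ 3| ≤ M * h2 ^ 4)
    (e1 : |um - u + v1 * h1 - v2 / 2 * h1 ^ 2 + v3 / 6 * h1 ^ 3| ≤ M * h1 ^ 4) :
    |2 / (h1 + h2) * ((up - u) / h2 - (u - um) / h1) - v2| ≤
      |h2 - h1| * |v3| + 2 * M * H ^ 2 := by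
  set R2 := up - u - v1 * h2 - v2 / 2 * h2 ^ 2 - v3 / 6 * h2 ^ 3 with hR2
  set R1 := um - u + v1 * h1 - v2 / 2 * h1 ^ 2 + v3 / 6 * h1 ^ 3 with hR1
  have hH : 0 < H := by linarith
  have k2 : |R2 / h2| ≤ M * H ^ 2 * h2 := by
    rw [abs_div, abs_of_pos p2, div_le_iff₀ p2]
    have : M * h2 ^ 2 * h2 ^ 2 ≤ M * H ^ 2 * h2 ^ 2 := by gcongr
    nlinarith
  have k1 : |R1 / h1| ≤ M * H ^ 2 * h1 := by
    rw [abs_div, abs_of_pos p1, div_le_iff₀ p1]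
    have : M * h1 ^ 2 * h1 ^ 2 ≤ M * H ^ 2 * h1 ^ 2 := by gcongr
    nlinarith
  have : 2 / (h1 + h2) * ((up - u) / h2 - (u - um) / h1) - v2 =
      (h2 - h1) * v3 / 3 + 2 / (h1 + h2) * (R2 / h2 + R1 / h1) := by
    rw [hR1, hR2]; field_simp; ring
  rw [this]
  refine (abs_add_le _ _).trans (add_le_add ?_ ?_)
  · rw [abs_div, abs_mul, abs_of_pos (by norm_num : (0:ℝ) < 3)]
    have : 0 ≤ |h2 - h1| * |v3| := by positivity
    linarith
  · rw [abs_mul, abs_of_pos (by positivity : 0 < 2 / (h1 + h2)), div_mul_eq_mul_div,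
      div_le_iff₀ (by positivity)]
    have := abs_add_le (R2 / h2) (R1 / h1)
    linarith

theorem interp_err {g g1 g2 : ℝ → ℝ} {c d M : ℝ} (hcd : c < d) (hM : 0 ≤ M)
    (h0 : ∀ y ∈ Icc c d, HasDerivWithinAt g (g1 y) (Icc c d) y)
    (h1 : ∀ y ∈ Icc c d, HasDerivWithinAt g1 (g2 y) (Icc c d) y)
    (hb : ∀ y ∈ Icc c d, |g2 y| ≤ M) :
    ∀ t ∈ Icc c d, |g c + (g d - g c) * (t - c) / (d - c) - g t| ≤ 2 * M * (d - c) ^ 2 := by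
  intro t ht
  have ht2 := taylor2 hM h0 h1 (left_mem_Icc.mpr hcd.le) hb t ht
  have hd2 := taylor2 hM h0 h1 (left_mem_Icc.mpr hcd.le) hb d (right_mem_Icc.mpr hcd.le)
  have hp : 0 < d - c := by linarith
  set Rt := g t - g c - g1 c * (t - c)
  set Rd := g d - g c - g1 c * (d - c) with hRd
  have e : g c + (g d - g c) * (t - c) / (d - c) - g t = Rd * ((t - c) / (d - c)) - Rt := by
    simp only [Rt, Rd]; field_simp; ring
  have w0 : 0 ≤ (t - c) / (d - c) := div_nonneg (by linarith [ht.1]) hp.le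
  have w1 : (t - c) / (d - c) ≤ 1 := by rw [div_le_one hp]; linarith [ht.2]
  rw [e]
  have e1 : |Rd * ((t - c) / (d - c))| ≤ M * (d - c) ^ 2 := by
    rw [abs_mul, abs_of_nonneg w0]
    rw [abs_of_pos hp] at hd2
    calc _ ≤ |Rd| * 1 := by gcongr
      _ ≤ _ := by linarith
  have e2 : |Rt| ≤ M * (d - c) ^ 2 := by
    refine ht2.trans ?_
    rw [abs_of_nonneg (by linarith [ht.1])]
    have : 0 ≤ t - c := by linarith [ht.1]
    have : t ≤ d := ht.2
    gcongr
  have := abs_sub (Rd * ((t - c) / (d - c))) Rt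
  linarith

theorem convex_bound {A B e s : ℝ} (hA : |A| ≤ e) (hB : |B| ≤ e) (h0 : 0 ≤ s) (h1 : s ≤ 1) :
    |A + (B - A) * s| ≤ e := by
  rw [abs_le] at *
  constructor <;> nlinarith

theorem ddiff_sub (x y v : ℕ → ℝ) (i : ℕ) :
    ddiff x (fun j => y j - v j) i = ddiff x y i - ddiff x v i := by
  unfold ddiff; ring

theorem disc_upper {x z : ℕ → ℝ} {n : ℕ} {ε c R : ℝ} (hc : 0 < c) (hR : 0 ≤ R)
    (hx : StrictMono x) (p r : ℕ → ℝ)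
    (hp : ∀ i, 1 ≤ i → i < n → c ≤ p i) (hr : ∀ i, 1 ≤ i → i < n → |r i| ≤ R)
    (he : ∀ i, 1 ≤ i → i < n → -ε ^ 2 * ddiff x z i + p i * z i = r i)
    (z0 : z 0 = 0) (zn : z n = 0) : ∀ i ≤ n, z i ≤ R / c := by
  obtain ⟨m, hm, hmax⟩ := Finset.exists_max_image (Finset.range (n + 1)) z ⟨0, by simp⟩
  have hmn : m ≤ n := by simpa [Nat.lt_succ_iff] using hm
  have hmax' : ∀ i ≤ n, z i ≤ z m := fun i hi => hmax i (by simpa [Nat.lt_succ_iff] using hi)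
  suffices h : z m ≤ R / c from fun i hi => (hmax' i hi).trans h
  by_contra hcon
  push Not at hcon
  have hzm : 0 < z m := lt_of_le_of_lt (by positivity) hcon
  have h1 : 1 ≤ m := by
    rcases Nat.eq_zero_or_pos m with h | h
    · rw [h, z0] at hzm; exact absurd hzm (lt_irrefl _)
    · exact h
  have h2 : m < n := by
    rcases hmn.eq_or_lt with h | h
    · rw [h, zn] at hzm; exact absurd hzm (lt_irrefl _)
    · exact h
  have hd : ddiff x z m ≤ 0 := by
    unfold ddiff
    have a1 : x (m - 1) < x m := hx (by omega)
    have a2 : x m < x (m + 1) := hx (by omega)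
    have b1 := hmax' (m - 1) (by omega)
    have b2 := hmax' (m + 1) (by omega)
    have c1 : 0 ≤ (z m - z (m - 1)) / (x m - x (m - 1)) :=
      div_nonneg (by linarith) (by linarith)
    have c2 : (z (m + 1) - z m) / (x (m + 1) - x m) ≤ 0 :=
      div_nonpos_of_nonpos_of_nonneg (by linarith) (by linarith)
    have c3 : 0 ≤ 2 / (x (m + 1) - x (m - 1)) := div_nonneg (by norm_num) (by linarith)
    exact mul_nonpos_of_nonneg_of_nonpos c3 (by linarith)
  have h3 := he m h1 h2
  have h4 := (abs_le.mp (hr m h1 h2)).2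
  have h5 := hp m h1 h2
  rw [div_lt_iff₀ hc] at hcon
  nlinarith [sq_nonneg ε]

theorem disc_stab {x z : ℕ → ℝ} {n : ℕ} {ε c R : ℝ} (hc : 0 < c) (hR : 0 ≤ R)
    (hx : StrictMono x) (p r : ℕ → ℝ)
    (hp : ∀ i, 1 ≤ i → i < n → c ≤ p i) (hr : ∀ i, 1 ≤ i → i < n → |r i| ≤ R)
    (he : ∀ i, 1 ≤ i → i < n → -ε ^ 2 * ddiff x z i + p i * z i = r i)
    (z0 : z 0 = 0) (zn : z n = 0) : ∀ i ≤ n, |z i| ≤ R / c := by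
  intro i hi
  rw [abs_le']
  refine ⟨disc_upper hc hR hx p r hp hr he z0 zn i hi, ?_⟩
  refine disc_upper (z := fun j => - z j) (ε := ε) hc hR hx p (fun j => - r j) hp
    (by simpa using hr) ?_ (by simpa using z0) (by simpa using zn) i hi
  intro i h1 h2
  have := he i h1 h2
  have e : ddiff x (fun j => - z j) i = - ddiff x z i := by unfold ddiff; ring
  rw [e]; linarith

/-- a function with layer-type derivative bounds; `v` is its smooth part -/
structure LayerBd (c₀ ε D : ℝ) (u u1 u2 u3 u4 v v1 v2 : ℝ → ℝ) : Prop where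
  d0 : ∀ y ∈ Icc (0:ℝ) 1, HasDerivWithinAt u (u1 y) (Icc 0 1) y
  d1 : ∀ y ∈ Icc (0:ℝ) 1, HasDerivWithinAt u1 (u2 y) (Icc 0 1) y
  d2 : ∀ y ∈ Icc (0:ℝ) 1, HasDerivWithinAt u2 (u3 y) (Icc 0 1) y
  d3 : ∀ y ∈ Icc (0:ℝ) 1, HasDerivWithinAt u3 (u4 y) (Icc 0 1) y
  b2 : ∀ y ∈ Icc (0:ℝ) 1, |u2 y| ≤ D * Pw c₀ ε y / ε ^ 2
  b3 : ∀ y ∈ Icc (0:ℝ) 1, |u3 y| ≤ D * Pw c₀ ε y / ε ^ 3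
  b4 : ∀ y ∈ Icc (0:ℝ) 1, |u4 y| ≤ D * Pw c₀ ε y / ε ^ 4
  e0 : ∀ y ∈ Icc (0:ℝ) 1, HasDerivWithinAt v (v1 y) (Icc 0 1) y
  e1 : ∀ y ∈ Icc (0:ℝ) 1, HasDerivWithinAt v1 (v2 y) (Icc 0 1) y
  f2 : ∀ y ∈ Icc (0:ℝ) 1, |v2 y| ≤ D
  w0 : ∀ y ∈ Icc (0:ℝ) 1, |u y - v y| ≤ D * Pw c₀ ε y

theorem Kp_nonneg (a q : ℝ) : 0 ≤ Kp a q := by unfold Kp; positivity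

theorem mesh_strictMono {a ε q α : ℝ} (hq : q ∈ Ioo (0:ℝ) (1/2)) (ha : 0 < a) (hε : 0 < ε)
    (hα : IsBakhAlpha a ε q α) {n : ℕ} (hn : 0 < n) : StrictMono (bakhMesh a ε q α n) := by
  intro i j hij
  have hn' : (0:ℝ) < n := by exact_mod_cast hn
  apply lam_strictMono hq ha hε hα
  gcongr

theorem lam_mem {a ε q α : ℝ} (hq : q ∈ Ioo (0:ℝ) (1/2)) (ha : 0 < a) (hε : 0 < ε)
    (hα : IsBakhAlpha a ε q α) {t : ℝ} (ht : t ∈ Icc (0:ℝ) 1) :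
    bakhLam a ε q α t ∈ Icc (0:ℝ) 1 := by
  have hm := (lam_strictMono hq ha hε hα).monotone
  have h0 := hm ht.1
  have h1 := hm ht.2
  rw [lam_zero hq.1 hα] at h0
  rw [lam_one hq hα] at h1
  exact ⟨h0, h1⟩

theorem lam_surj {a ε q α : ℝ} (hq : q ∈ Ioo (0:ℝ) (1/2))
    (hα : IsBakhAlpha a ε q α) {s t y : ℝ} (hst : s ≤ t)
    (hy : y ∈ Icc (bakhLam a ε q α s) (bakhLam a ε q α t)) :
    ∃ r ∈ Icc s t, bakhLam a ε q α r = y :=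
  intermediate_value_Icc hst
    (fun x _ => (lam_hasDeriv hq hα x).continuousAt.continuousWithinAt) hy

/-- bound for the weight on a cell -/
theorem Pw_cell {a ε q α c₀ : ℝ} (hq : q ∈ Ioo (0:ℝ) (1/2)) (ha : 0 < a) (hε : 0 < ε)
    (hc₀ : 0 < c₀) (hac : 2 ≤ a * c₀)
    (hα : IsBakhAlpha a ε q α) {s t : ℝ} (hs : 0 ≤ s) (ht : t ≤ 1) (hst : s ≤ t) {K : ℝ}
    (hK : ∀ r ∈ Icc s t, kap q α r ≤ K) {y : ℝ}
    (hy : y ∈ Icc (bakhLam a ε q α s) (bakhLam a ε q α t)) :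
    Pw c₀ ε y ≤ Kp a q * K ^ 2 := by
  obtain ⟨r, hr, rfl⟩ := lam_surj hq hα hst hy
  refine (Pw_lam hq ha hε hc₀ hac hα ⟨hs.trans hr.1, hr.2.trans ht⟩).trans ?_
  have h1 := hK r hr
  have h2 := kap_pos hα.1.2 r
  have := Kp_nonneg a q
  gcongr

/-- truncation constant -/
def Ct (a q D : ℝ) : ℝ := D * Kp a q * (32 * a + 32 * a ^ 2 + 75)

theorem trunc {a ε q α c₀ D : ℝ} (hq : q ∈ Ioo (0:ℝ) (1/2)) (ha : 0 < a) (hε : 0 < ε)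
    (hc₀ : 0 < c₀) (hac : 2 ≤ a * c₀) (hα : IsBakhAlpha a ε q α) (hD : 0 ≤ D)
    {u u1 u2 u3 u4 v v1 v2 : ℝ → ℝ} (L : LayerBd c₀ ε D u u1 u2 u3 u4 v v1 v2)
    {n i : ℕ} (hi : 1 ≤ i) (hin : i < n) :
    |ε ^ 2 * (ddiff (bakhMesh a ε q α n) (fun j => u (bakhMesh a ε q α n j)) i
      - u2 (bakhMesh a ε q α n i))| ≤ Ct a q D * ((n:ℝ) ^ 2)⁻¹ := by
  have hn : 0 < n := by omega
  have hn' : (0:ℝ) < n := by exact_mod_cast hn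
  set δ : ℝ := (n:ℝ)⁻¹ with hδ
  have hδ0 : 0 < δ := by positivity
  have hnδ : (n:ℝ) * δ = 1 := by rw [hδ]; field_simp
  set t : ℝ := (i:ℝ) / n with ht
  have htn : t = i * δ := by rw [ht, hδ]; field_simp
  have hi1 : (1:ℝ) ≤ i := by exact_mod_cast hi
  have hi2 : (i:ℝ) + 1 ≤ n := by exact_mod_cast hin
  have em : ((i - 1 : ℕ) : ℝ) / n = t - δ := by
    rw [Nat.cast_sub hi, htn, hδ]; push_cast; field_simp
  have ep : ((i + 1 : ℕ) : ℝ) / n = t + δ := by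
    rw [htn, hδ]; push_cast; field_simp
  have hlo : 0 ≤ t - δ := by rw [htn]; nlinarith
  have hhi : t + δ ≤ 1 := by rw [htn, ← hnδ]; nlinarith
  set lam := bakhLam a ε q α with hlam
  set X := lam t with hX
  set Xm := lam (t - δ) with hXm
  set Xp := lam (t + δ) with hXp
  have hsm := lam_strictMono hq ha hε hα
  have lt1 : Xm < X := hsm (by linarith)
  have lt2 : X < Xp := hsm (by linarith)
  have mm : Xm ∈ Icc (0:ℝ) 1 := lam_mem hq ha hε hα ⟨hlo, by linarith⟩
  have mp : Xp ∈ Icc (0:ℝ) 1 := lam_mem hq ha hε hα ⟨by linarith, hhi⟩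
  have hsub : Icc Xm Xp ⊆ Icc 0 1 := Icc_subset_Icc mm.1 mp.2
  have hXi : X ∈ Icc Xm Xp := ⟨lt1.le, lt2.le⟩
  have d0 := fun y hy => (L.d0 y (hsub hy)).mono hsub
  have d1 := fun y hy => (L.d1 y (hsub hy)).mono hsub
  have d2 := fun y hy => (L.d2 y (hsub hy)).mono hsub
  have d3 := fun y hy => (L.d3 y (hsub hy)).mono hsub
  have hdd : ddiff (bakhMesh a ε q α n) (fun j => u (bakhMesh a ε q α n j)) i =
      2 / ((X - Xm) + (Xp - X)) * ((u Xp - u X) / (Xp - X) - (u X - u Xm) / (X - Xm)) := by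
    unfold ddiff bakhMesh
    simp only [em, ep]
    rw [show (X - Xm) + (Xp - X) = Xp - Xm by ring]
  have hXX : bakhMesh a ε q α n i = X := rfl
  rw [hdd, hXX]
  set k := kap q α t with hk
  have hkp : 0 < k := kap_pos hα.1.2 t
  have hKp := Kp_nonneg a q
  have hinv : ((n:ℝ) ^ 2)⁻¹ = δ ^ 2 := by rw [hδ, inv_pow]
  rw [hinv, abs_mul, abs_of_nonneg (sq_nonneg ε)]
  have hnear : ∀ r ∈ Icc (t - δ) (t + δ), |kap q α r - k| ≤ δ := by
    intro r hr
    refine (kap_lip q α r t).trans ?_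
    rw [abs_le]; constructor <;> linarith [hr.1, hr.2]
  have hP := fun K hK y hy => Pw_cell hq ha hε hc₀ hac hα hlo hhi (by linarith) (K := K) hK
    (y := y) hy
  rcases le_total (4 * δ) k with hc | hc
  · -- resolved case
    have kl : ∀ r ∈ Icc (t - δ) (t + δ), k / 2 ≤ kap q α r := by
      intro r hr; have := (abs_le.mp (hnear r hr)).1; linarith
    have ku : ∀ r ∈ Icc (t - δ) (t + δ), kap q α r ≤ 2 * k := by
      intro r hr; have := (abs_le.mp (hnear r hr)).2; linarith
    have hPw := hP (2 * k) ku
    obtain ⟨x1, hx1, e1⟩ := lam_mvt hq hα (show t - δ < t by linarith)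
    obtain ⟨x2, hx2, e2⟩ := lam_mvt hq hα (show t < t + δ by linarith)
    have i1 : x1 ∈ Icc (t - δ) (t + δ) := ⟨hx1.1.le, by linarith [hx1.2]⟩
    have i2 : x2 ∈ Icc (t - δ) (t + δ) := ⟨by linarith [hx2.1], hx2.2.le⟩
    rw [show t - (t - δ) = δ by ring] at e1
    rw [show t + δ - t = δ by ring] at e2
    have l1 := kl x1 i1
    have l2 := kl x2 i2
    have hκ1 := kap_pos hα.1.2 x1
    have hκ2 := kap_pos hα.1.2 x2
    set H := 2 * a * ε * δ / k with hH
    have H1 : X - Xm ≤ H := by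
      rw [e1]
      calc a * ε / kap q α x1 * δ ≤ a * ε / (k / 2) * δ := by gcongr
        _ = H := by rw [hH]; field_simp
    have H2 : Xp - X ≤ H := by
      rw [e2]
      calc a * ε / kap q α x2 * δ ≤ a * ε / (k / 2) * δ := by gcongr
        _ = H := by rw [hH]; field_simp
    have H3 : |(Xp - X) - (X - Xm)| ≤ 8 * a * ε * δ ^ 2 / k ^ 2 := by
      rw [e1, e2]
      have : a * ε / kap q α x2 * δ - a * ε / kap q α x1 * δ =
          a * ε * δ * (kap q α x1 - kap q α x2) / (kap q α x1 * kap q α x2) := by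
        field_simp
      rw [this, abs_div, abs_of_pos (mul_pos hκ1 hκ2), abs_mul,
        abs_of_pos (by positivity : 0 < a * ε * δ)]
      have hdiff : |kap q α x1 - kap q α x2| ≤ 2 * δ := by
        refine (kap_lip q α x1 x2).trans ?_
        rw [abs_le]; constructor <;> linarith [i1.1, i1.2, i2.1, i2.2]
      calc _ ≤ a * ε * δ * (2 * δ) / (k / 2 * (k / 2)) := by gcongr
        _ = _ := by field_simp; ring
    set M := 4 * D * Kp a q * k ^ 2 / ε ^ 4 with hM
    have hM0 : 0 ≤ M := by positivity
    have hb4 : ∀ y ∈ Icc Xm Xp, |u4 y| ≤ M := by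
      intro y hy
      refine (L.b4 y (hsub hy)).trans ?_
      calc _ ≤ D * (Kp a q * (2 * k) ^ 2) / ε ^ 4 := by have := hPw y hy; gcongr
        _ = M := by rw [hM]; ring
    have hb3 : |u3 X| ≤ 4 * D * Kp a q * k ^ 2 / ε ^ 3 := by
      refine (L.b3 X (hsub hXi)).trans ?_
      calc _ ≤ D * (Kp a q * (2 * k) ^ 2) / ε ^ 3 := by have := hPw X hXi; gcongr
        _ = _ := by ring
    have T := taylor4 hM0 d0 d1 d2 d3 hXi hb4
    have Tp := T Xp ⟨by linarith, le_rfl⟩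
    have Tm := T Xm ⟨le_rfl, by linarith⟩
    rw [abs_of_pos (show 0 < Xp - X by linarith)] at Tp
    rw [abs_of_neg (show Xm - X < 0 by linarith), neg_sub] at Tm
    have Tm' : |u Xm - u X + u1 X * (X - Xm) - u2 X / 2 * (X - Xm) ^ 2
        + u3 X / 6 * (X - Xm) ^ 3| ≤ M * (X - Xm) ^ 4 := by
      refine le_of_eq_of_le ?_ Tm
      congr 1; ring
    have F := ddiff_alg4 hM0 (show 0 < X - Xm by linarith) (show 0 < Xp - X by linarith)
      H1 H2 Tp Tm'
    calc _ ≤ ε ^ 2 * (|(Xp - X) - (X - Xm)| * |u3 X| + 2 * M * H ^ 2) := by gcongr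
      _ ≤ ε ^ 2 * ((8 * a * ε * δ ^ 2 / k ^ 2) * (4 * D * Kp a q * k ^ 2 / ε ^ 3)
            + 2 * M * H ^ 2) := by gcongr
      _ = D * Kp a q * (32 * a + 32 * a ^ 2) * δ ^ 2 := by
          rw [hM, hH]; field_simp; ring
      _ ≤ Ct a q D * δ ^ 2 := by
          unfold Ct
          have h75 : 32 * a + 32 * a ^ 2 ≤ 32 * a + 32 * a ^ 2 + 75 := by linarith
          exact mul_le_mul_of_nonneg_right (mul_le_mul_of_nonneg_left h75 (by positivity))
            (by positivity)
  · have ku : ∀ r ∈ Icc (t - δ) (t + δ), kap q α r ≤ 5 * δ := by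
      intro r hr; have := (abs_le.mp (hnear r hr)).2; linarith
    have hPw := hP (5 * δ) ku
    set M := 25 * D * Kp a q * δ ^ 2 / ε ^ 2 with hM
    have hM0 : 0 ≤ M := by positivity
    have hb2 : ∀ y ∈ Icc Xm Xp, |u2 y| ≤ M := by
      intro y hy
      refine (L.b2 y (hsub hy)).trans ?_
      calc _ ≤ D * (Kp a q * (5 * δ) ^ 2) / ε ^ 2 := by have := hPw y hy; gcongr
        _ = M := by rw [hM]; ring
    have T := taylor2 hM0 d0 d1 hXi hb2
    have Tp := T Xp ⟨by linarith, le_rfl⟩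
    have Tm := T Xm ⟨le_rfl, by linarith⟩
    rw [abs_of_pos (show 0 < Xp - X by linarith)] at Tp
    rw [abs_of_neg (show Xm - X < 0 by linarith), neg_sub] at Tm
    have Tm' : |u Xm - u X + u1 X * (X - Xm)| ≤ M * (X - Xm) ^ 2 := by
      refine le_of_eq_of_le ?_ Tm
      congr 1; ring
    have F := ddiff_alg2 (show 0 < X - Xm by linarith) (show 0 < Xp - X by linarith) Tp Tm'
    have F2 := hb2 X hXi
    have F3 := abs_sub (2 / ((X - Xm) + (Xp - X)) *
      ((u Xp - u X) / (Xp - X) - (u X - u Xm) / (X - Xm))) (u2 X)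
    calc _ ≤ ε ^ 2 * (3 * M) := by gcongr; linarith
      _ = D * Kp a q * 75 * δ ^ 2 := by rw [hM]; field_simp; ring
      _ ≤ Ct a q D * δ ^ 2 := by
          unfold Ct; gcongr
          have : 0 ≤ 32 * a + 32 * a ^ 2 := by positivity
          linarith

/-- interpolation constant -/
def Ci (a q D : ℝ) : ℝ := D * Kp a q * (32 * a ^ 2 + 50) + 2 * D * (1 - 2 * q)⁻¹ ^ 2

theorem cell_interp {a ε q α c₀ D : ℝ} (hq : q ∈ Ioo (0:ℝ) (1/2)) (ha : 0 < a) (hε : 0 < ε)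
    (hc₀ : 0 < c₀) (hac : 2 ≤ a * c₀) (hα : IsBakhAlpha a ε q α) (hD : 0 ≤ D)
    {u u1 u2 u3 u4 v v1 v2 : ℝ → ℝ} (L : LayerBd c₀ ε D u u1 u2 u3 u4 v v1 v2)
    {t δ : ℝ} (hδ0 : 0 < δ) (hlo : 0 ≤ t) (hhi : t + δ ≤ 1) :
    ∀ y ∈ Icc (bakhLam a ε q α t) (bakhLam a ε q α (t + δ)),
      |u (bakhLam a ε q α t) + (u (bakhLam a ε q α (t + δ)) - u (bakhLam a ε q α t)) *
        (y - bakhLam a ε q α t) / (bakhLam a ε q α (t + δ) - bakhLam a ε q α t) - u y|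
        ≤ Ci a q D * δ ^ 2 := by
  set lam := bakhLam a ε q α with hlam
  set X := lam t with hX
  set Xp := lam (t + δ) with hXp
  have hsm := lam_strictMono hq ha hε hα
  have lt2 : X < Xp := hsm (by linarith)
  have mm : X ∈ Icc (0:ℝ) 1 := lam_mem hq ha hε hα ⟨hlo, by linarith⟩
  have mp : Xp ∈ Icc (0:ℝ) 1 := lam_mem hq ha hε hα ⟨by linarith, hhi⟩
  have hsub : Icc X Xp ⊆ Icc 0 1 := Icc_subset_Icc mm.1 mp.2
  have d0 := fun y hy => (L.d0 y (hsub hy)).mono hsub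
  have d1 := fun y hy => (L.d1 y (hsub hy)).mono hsub
  have e0 := fun y hy => (L.e0 y (hsub hy)).mono hsub
  have e1 := fun y hy => (L.e1 y (hsub hy)).mono hsub
  set k := kap q α t with hk
  have hkp : 0 < k := kap_pos hα.1.2 t
  have hKp := Kp_nonneg a q
  have hnear : ∀ r ∈ Icc t (t + δ), |kap q α r - k| ≤ δ := by
    intro r hr
    refine (kap_lip q α r t).trans ?_
    rw [abs_le]; constructor <;> linarith [hr.1, hr.2]
  have hP := fun K hK y hy => Pw_cell hq ha hε hc₀ hac hα hlo hhi (by linarith) (K := K) hK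
    (y := y) hy
  obtain ⟨x2, hx2, ee⟩ := lam_mvt hq hα (show t < t + δ by linarith)
  have i2 : x2 ∈ Icc t (t + δ) := ⟨hx2.1.le, hx2.2.le⟩
  rw [show t + δ - t = δ by ring] at ee
  have hκ2 := kap_pos hα.1.2 x2
  have hd : 0 < 1 - 2 * q := by linarith [hq.2]
  intro y hy
  rcases le_total (4 * δ) k with hc | hc
  · have kl : ∀ r ∈ Icc t (t + δ), k / 2 ≤ kap q α r := by
      intro r hr; have := (abs_le.mp (hnear r hr)).1; linarith
    have ku : ∀ r ∈ Icc t (t + δ), kap q α r ≤ 2 * k := by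
      intro r hr; have := (abs_le.mp (hnear r hr)).2; linarith
    have hPw := hP (2 * k) ku
    have l2 := kl x2 i2
    set H := 2 * a * ε * δ / k with hH
    have H2 : Xp - X ≤ H := by
      rw [ee]
      calc a * ε / kap q α x2 * δ ≤ a * ε / (k / 2) * δ := by gcongr
        _ = H := by rw [hH]; field_simp
    set M := 4 * D * Kp a q * k ^ 2 / ε ^ 2 with hM
    have hM0 : 0 ≤ M := by positivity
    have hb2 : ∀ y ∈ Icc X Xp, |u2 y| ≤ M := by
      intro y hy
      refine (L.b2 y (hsub hy)).trans ?_
      calc _ ≤ D * (Kp a q * (2 * k) ^ 2) / ε ^ 2 := by have := hPw y hy; gcongr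
        _ = M := by rw [hM]; ring
    refine (interp_err lt2 hM0 d0 d1 hb2 y hy).trans ?_
    have : 0 ≤ Xp - X := by linarith
    calc 2 * M * (Xp - X) ^ 2 ≤ 2 * M * H ^ 2 := by gcongr
      _ = D * Kp a q * (32 * a ^ 2) * δ ^ 2 := by rw [hM, hH]; field_simp; ring
      _ ≤ _ := by
        unfold Ci
        have : 0 ≤ D * Kp a q * 50 + 2 * D * (1 - 2 * q)⁻¹ ^ 2 := by positivity
        gcongr; linarith
  · have ku : ∀ r ∈ Icc t (t + δ), kap q α r ≤ 5 * δ := by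
      intro r hr; have := (abs_le.mp (hnear r hr)).2; linarith
    have hPw := hP (5 * δ) ku
    have hw : ∀ y ∈ Icc X Xp, |u y - v y| ≤ 25 * D * Kp a q * δ ^ 2 := by
      intro y hy
      refine (L.w0 y (hsub hy)).trans ?_
      calc _ ≤ D * (Kp a q * (5 * δ) ^ 2) := by have := hPw y hy; gcongr
        _ = _ := by ring
    have H2 : Xp - X ≤ (1 - 2 * q)⁻¹ * δ := by
      rw [ee]
      have hkl := kap_lower hq ha hε hα x2
      calc a * ε / kap q α x2 * δ ≤ a * ε / (a * ε * (1 - 2 * q)) * δ := by gcongr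
        _ = _ := by field_simp
    have I1 := interp_err lt2 hD e0 e1 (fun y hy => L.f2 y (hsub hy)) y hy
    have wX := hw X ⟨le_rfl, lt2.le⟩
    have wXp := hw Xp ⟨lt2.le, le_rfl⟩
    have wy := hw y hy
    have hs0 : 0 ≤ (y - X) / (Xp - X) := div_nonneg (by linarith [hy.1]) (by linarith)
    have hs1 : (y - X) / (Xp - X) ≤ 1 := by
      rw [div_le_one (by linarith)]; linarith [hy.2]
    have I2 := convex_bound wX wXp hs0 hs1
    have e : u X + (u Xp - u X) * (y - X) / (Xp - X) - u y =
        (v X + (v Xp - v X) * (y - X) / (Xp - X) - v y)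
        + (((u X - v X) + ((u Xp - v Xp) - (u X - v X)) * ((y - X) / (Xp - X))) - (u y - v y)) := by
      ring
    rw [e]
    have : 0 ≤ Xp - X := by linarith
    have I3 : 2 * D * (Xp - X) ^ 2 ≤ 2 * D * ((1 - 2 * q)⁻¹ * δ) ^ 2 := by gcongr
    have I4 : 0 ≤ D * Kp a q * (32 * a ^ 2) * δ ^ 2 := by positivity
    refine (abs_add_le _ _).trans ?_
    have I5 := abs_sub ((u X - v X) + ((u Xp - v Xp) - (u X - v X)) * ((y - X) / (Xp - X)))
      (u y - v y)
    have I6 : Ci a q D * δ ^ 2 = D * Kp a q * (32 * a ^ 2) * δ ^ 2 + 2 * (25 * D * Kp a q * δ ^ 2)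
        + 2 * D * ((1 - 2 * q)⁻¹ * δ) ^ 2 := by unfold Ci; ring
    rw [I6]
    linarith

theorem mesh_interp {a ε q α c₀ D : ℝ} (hq : q ∈ Ioo (0:ℝ) (1/2)) (ha : 0 < a) (hε : 0 < ε)
    (hc₀ : 0 < c₀) (hac : 2 ≤ a * c₀) (hα : IsBakhAlpha a ε q α) (hD : 0 ≤ D)
    {u u1 u2 u3 u4 v v1 v2 : ℝ → ℝ} (L : LayerBd c₀ ε D u u1 u2 u3 u4 v v1 v2)
    {n : ℕ} (hn : 0 < n) {y : ℕ → ℝ} {w : ℝ → ℝ} (hw : IsLinInterp (bakhMesh a ε q α n) n y w)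
    {e : ℝ} (he : ∀ i ≤ n, |y i - u (bakhMesh a ε q α n i)| ≤ e) :
    ∀ x ∈ Icc (0:ℝ) 1, |w x - u x| ≤ e + Ci a q D * ((n:ℝ) ^ 2)⁻¹ := by
  intro x hx
  have hn' : (0:ℝ) < n := by exact_mod_cast hn
  obtain ⟨s, hs, rfl⟩ := lam_surj hq hα (s := 0) (t := 1) (y := x) zero_le_one
    (by rw [lam_zero hq.1 hα, lam_one hq hα]; exact hx)
  -- locate the cell
  obtain ⟨i, hin, hi1, hi2⟩ : ∃ i < n, (i:ℝ) ≤ s * n ∧ s * n ≤ i + 1 := by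
    have hsn : 0 ≤ s * n := mul_nonneg hs.1 hn'.le
    by_cases h : s = 1
    · refine ⟨n - 1, by omega, ?_, ?_⟩ <;> rw [Nat.cast_sub hn, h] <;> push_cast <;> linarith
    · refine ⟨⌊s * n⌋₊, ?_, Nat.floor_le hsn, (Nat.lt_floor_add_one _).le⟩
      rw [Nat.floor_lt hsn]
      have : s < 1 := lt_of_le_of_ne hs.2 h
      nlinarith
  set δ : ℝ := (n:ℝ)⁻¹ with hδ
  have hδ0 : 0 < δ := by positivity
  have ep : ((i + 1 : ℕ) : ℝ) / n = (i:ℝ) / n + δ := by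
    rw [hδ]; push_cast; field_simp
  have hlo : 0 ≤ (i:ℝ) / n := by positivity
  have hhi : (i:ℝ) / n + δ ≤ 1 := by
    rw [← ep, div_le_one hn']; exact_mod_cast hin
  have hsm := lam_strictMono hq ha hε hα
  have m1 : bakhLam a ε q α (i / n) ≤ bakhLam a ε q α s :=
    hsm.monotone (by rwa [div_le_iff₀ hn'])
  have m2 : bakhLam a ε q α s ≤ bakhLam a ε q α (i / n + δ) :=
    hsm.monotone (by rw [← ep, le_div_iff₀ hn']; push_cast; exact hi2)
  have lt2 : bakhLam a ε q α (i / n) < bakhLam a ε q α (i / n + δ) := hsm (by linarith)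
  have C := cell_interp hq ha hε hc₀ hac hα hD L hδ0 hlo hhi _ ⟨m1, m2⟩
  have W := hw.2 i hin (bakhLam a ε q α s)
  have y1 := he i hin.le
  have y2 := he (i + 1) hin
  unfold bakhMesh at W y1 y2
  rw [ep] at W y2
  rw [W ⟨m1, m2⟩]
  set X := bakhLam a ε q α (i / n)
  set Xp := bakhLam a ε q α (i / n + δ)
  set Y := bakhLam a ε q α s
  have hs0 : 0 ≤ (Y - X) / (Xp - X) := div_nonneg (by linarith) (by linarith)
  have hs1 : (Y - X) / (Xp - X) ≤ 1 := by
    rw [div_le_one (by linarith)]; linarith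
  have I2 := convex_bound y1 y2 hs0 hs1
  have eq : y i + (y (i + 1) - y i) * (Y - X) / (Xp - X) - u Y =
      ((y i - u X) + ((y (i + 1) - u Xp) - (y i - u X)) * ((Y - X) / (Xp - X)))
      + (u X + (u Xp - u X) * (Y - X) / (Xp - X) - u Y) := by ring
  rw [eq]
  refine (abs_add_le _ _).trans ?_
  rw [← inv_pow]
  exact add_le_add I2 C

/-- the strip `[0,1] × ℝ` -/
def S01 : Set (ℝ × ℝ) := (Icc (0:ℝ) 1) ×ˢ (univ : Set ℝ)

theorem mem_S01 {x y : ℝ} (hx : x ∈ Icc (0:ℝ) 1) : (x, y) ∈ S01 := ⟨hx, mem_univ _⟩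

theorem split_deriv {k : ℕ} {F : ℝ × ℝ → ℝ} (hF : ContDiffOn ℝ ((k + 1 : ℕ) : WithTop ℕ∞) F S01) :
    ∃ Fx Fu : ℝ × ℝ → ℝ, ContDiffOn ℝ (k : WithTop ℕ∞) Fx S01 ∧
      ContDiffOn ℝ (k : WithTop ℕ∞) Fu S01 ∧
      ∀ p ∈ S01, HasFDerivWithinAt F (Fx p • ContinuousLinearMap.fst ℝ ℝ ℝ
        + Fu p • ContinuousLinearMap.snd ℝ ℝ ℝ) S01 p := by
  have hU : UniqueDiffOn ℝ S01 := (uniqueDiffOn_Icc zero_lt_one).prod uniqueDiffOn_univ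
  have h1 : ContDiffOn ℝ (k : WithTop ℕ∞) (fderivWithin ℝ F S01) S01 :=
    hF.fderivWithin hU (by push_cast; exact le_rfl)
  refine ⟨fun p => fderivWithin ℝ F S01 p (1, 0), fun p => fderivWithin ℝ F S01 p (0, 1),
    h1.clm_apply contDiffOn_const, h1.clm_apply contDiffOn_const, ?_⟩
  intro p hp
  have hd : DifferentiableWithinAt ℝ F S01 p :=
    (hF.differentiableOn (by norm_num)) p hp
  have := hd.hasFDerivWithinAt
  refine this.congr_fderiv ?_
  ext <;> simp

theorem chain_strip {F : ℝ × ℝ → ℝ} {A B : ℝ} {g : ℝ → ℝ} {g' x : ℝ}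
    (hF : HasFDerivWithinAt F (A • ContinuousLinearMap.fst ℝ ℝ ℝ
        + B • ContinuousLinearMap.snd ℝ ℝ ℝ) S01 (x, g x))
    (hg : HasDerivWithinAt g g' (Icc (0:ℝ) 1) x) :
    HasDerivWithinAt (fun t => F (t, g t)) (A + B * g') (Icc (0:ℝ) 1) x := by
  have h1 : HasDerivWithinAt (fun t => (t, g t)) ((1:ℝ), g') (Icc (0:ℝ) 1) x :=
    (hasDerivWithinAt_id x _).prodMk hg
  have h2 := HasFDerivWithinAt.comp_hasDerivWithinAt (t := S01) x hF h1
    (fun t ht => mem_S01 ht)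
  refine h2.congr_deriv ?_
  simp

theorem partial_strip {F : ℝ × ℝ → ℝ} {A B : ℝ} {x y : ℝ} (hx : x ∈ Icc (0:ℝ) 1)
    (hF : HasFDerivWithinAt F (A • ContinuousLinearMap.fst ℝ ℝ ℝ
        + B • ContinuousLinearMap.snd ℝ ℝ ℝ) S01 (x, y)) :
    HasDerivAt (fun z => F (x, z)) B y := by
  have h1 : HasDerivWithinAt (fun z => (x, z)) ((0:ℝ), (1:ℝ)) univ y :=
    (hasDerivWithinAt_const y _ x).prodMk (hasDerivWithinAt_id y _)
  have h2 := HasFDerivWithinAt.comp_hasDerivWithinAt (t := S01) y hF h1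
    (fun t ht => mem_S01 hx)
  rw [hasDerivWithinAt_univ] at h2
  refine h2.congr_deriv ?_
  simp

/-- derivative data of `f` -/
structure FD (f : ℝ → ℝ → ℝ) (c₀ : ℝ) (fx fu fxx fxu fux fuu : ℝ × ℝ → ℝ) : Prop where
  cx : ContinuousOn fx S01
  cu : ContinuousOn fu S01
  cxx : ContinuousOn fxx S01
  cxu : ContinuousOn fxu S01
  cux : ContinuousOn fux S01
  cuu : ContinuousOn fuu S01
  D : ∀ p ∈ S01, HasFDerivWithinAt (fun p : ℝ × ℝ => f p.1 p.2)
    (fx p • ContinuousLinearMap.fst ℝ ℝ ℝ + fu p • ContinuousLinearMap.snd ℝ ℝ ℝ) S01 p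
  Dx : ∀ p ∈ S01, HasFDerivWithinAt fx
    (fxx p • ContinuousLinearMap.fst ℝ ℝ ℝ + fxu p • ContinuousLinearMap.snd ℝ ℝ ℝ) S01 p
  Du : ∀ p ∈ S01, HasFDerivWithinAt fu
    (fux p • ContinuousLinearMap.fst ℝ ℝ ℝ + fuu p • ContinuousLinearMap.snd ℝ ℝ ℝ) S01 p
  pd : ∀ x ∈ Icc (0:ℝ) 1, ∀ y, pderiv1 f x y = fu (x, y)
  lower : ∀ p ∈ S01, c₀ ^ 2 ≤ fu p

theorem exists_FD {f : ℝ → ℝ → ℝ} {c₀ : ℝ} (hf : SmoothF f) (hfu : LowerF f c₀) :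
    ∃ fx fu fxx fxu fux fuu : ℝ × ℝ → ℝ, FD f c₀ fx fu fxx fxu fux fuu := by
  have h2 : ContDiffOn ℝ ((1 + 1 : ℕ) : WithTop ℕ∞) (fun p : ℝ × ℝ => f p.1 p.2) S01 :=
    ContDiffOn.of_le hf (by norm_num)
  obtain ⟨fx, fu, hx, hu, hD⟩ := split_deriv h2
  obtain ⟨fxx, fxu, hxx, hxu, hDx⟩ := split_deriv (k := 0) hx
  obtain ⟨fux, fuu, hux, huu, hDu⟩ := split_deriv (k := 0) hu
  have pd : ∀ x ∈ Icc (0:ℝ) 1, ∀ y, pderiv1 f x y = fu (x, y) := fun x hx y =>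
    (partial_strip hx (hD (x, y) (mem_S01 hx))).deriv
  refine ⟨fx, fu, fxx, fxu, fux, fuu, hx.continuousOn, hu.continuousOn, hxx.continuousOn,
    hxu.continuousOn, hux.continuousOn, huu.continuousOn, hD, hDx, hDu, pd, ?_⟩
  rintro ⟨x, y⟩ hp
  rw [← pd x hp.1 y]
  exact hfu x hp.1 y

theorem bound_strip {F : ℝ × ℝ → ℝ} (hF : ContinuousOn F S01) (R : ℝ) :
    ∃ B, 0 ≤ B ∧ ∀ x ∈ Icc (0:ℝ) 1, ∀ y, |y| ≤ R → |F (x, y)| ≤ B := by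
  have hK : IsCompact ((Icc (0:ℝ) 1) ×ˢ (Icc (-R) R)) := isCompact_Icc.prod isCompact_Icc
  obtain ⟨C, hC⟩ := hK.exists_bound_of_continuousOn (f := F)
    (hF.mono (prod_mono le_rfl (subset_univ _)))
  refine ⟨max C 0, le_max_right _ _, fun x hx y hy => ?_⟩
  exact (hC (x, y) ⟨hx, abs_le.mp hy⟩).trans (le_max_left _ _)

theorem f_slope {f : ℝ → ℝ → ℝ} {c₀ : ℝ} {fx fu fxx fxu fux fuu : ℝ × ℝ → ℝ}
    (F : FD f c₀ fx fu fxx fxu fux fuu) {x y z : ℝ} (hx : x ∈ Icc (0:ℝ) 1) (hyz : y ≤ z) :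
    c₀ ^ 2 * (z - y) ≤ f x z - f x y := by
  have hd : ∀ z, HasDerivAt (fun z => f x z) (fu (x, z)) z := fun z =>
    partial_strip hx (F.D (x, z) (mem_S01 hx))
  exact mul_sub_le_image_sub_of_le_deriv (fun z => (hd z).differentiableAt)
    (fun z => by rw [(hd z).deriv]; exact F.lower _ (mem_S01 hx)) hyz

theorem f_root {f : ℝ → ℝ → ℝ} {c₀ : ℝ} {fx fu fxx fxu fux fuu : ℝ × ℝ → ℝ}
    (F : FD f c₀ fx fu fxx fxu fux fuu) (hc₀ : 0 < c₀) {x : ℝ} (hx : x ∈ Icc (0:ℝ) 1) :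
    ∃ z, f x z = 0 ∧ |z| ≤ |f x 0| / c₀ ^ 2 := by
  set Z := |f x 0| / c₀ ^ 2 with hZ
  have hZ0 : 0 ≤ Z := by positivity
  have hZc : c₀ ^ 2 * Z = |f x 0| := by rw [hZ]; field_simp
  have h1 := f_slope F hx hZ0
  have h2 := f_slope F hx (show -Z ≤ 0 by linarith)
  have hd : ∀ z, HasDerivAt (fun z => f x z) (fu (x, z)) z := fun z =>
    partial_strip hx (F.D (x, z) (mem_S01 hx))
  have h3 : (0:ℝ) ∈ Icc (f x (-Z)) (f x Z) := by
    constructor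
    · have := le_abs_self (f x 0); linarith
    · have := neg_abs_le (f x 0); linarith
  obtain ⟨z, hz, e⟩ := intermediate_value_Icc (f := fun z => f x z) (show -Z ≤ Z by linarith)
    (fun z _ => (hd z).continuousAt.continuousWithinAt) h3
  exact ⟨z, e, abs_le.mpr hz⟩

theorem reduced {f : ℝ → ℝ → ℝ} {c₀ : ℝ} {fx fu fxx fxu fux fuu : ℝ × ℝ → ℝ}
    (F : FD f c₀ fx fu fxx fxu fux fuu) (hc₀ : 0 < c₀) :
    ∃ v v1 v2 : ℝ → ℝ, ∃ M : ℝ, 0 ≤ M ∧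
      (∀ x ∈ Icc (0:ℝ) 1, f x (v x) = 0) ∧
      (∀ x ∈ Icc (0:ℝ) 1, HasDerivWithinAt v (v1 x) (Icc 0 1) x) ∧
      (∀ x ∈ Icc (0:ℝ) 1, HasDerivWithinAt v1 (v2 x) (Icc 0 1) x) ∧
      (∀ x ∈ Icc (0:ℝ) 1, |v x| ≤ M) ∧ (∀ x ∈ Icc (0:ℝ) 1, |v1 x| ≤ M) ∧
      (∀ x ∈ Icc (0:ℝ) 1, |v2 x| ≤ M) := by
  have hex : ∀ x : ℝ, ∃ z, x ∈ Icc (0:ℝ) 1 → f x z = 0 ∧ |z| ≤ |f x 0| / c₀ ^ 2 := by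
    intro x
    by_cases hx : x ∈ Icc (0:ℝ) 1
    · obtain ⟨z, hz⟩ := f_root F hc₀ hx
      exact ⟨z, fun _ => hz⟩
    · exact ⟨0, fun h => absurd h hx⟩
  choose v hv using hex
  have hv0 : ∀ x ∈ Icc (0:ℝ) 1, f x (v x) = 0 := fun x hx => (hv x hx).1
  have hc2 : 0 < c₀ ^ 2 := by positivity
  have cf : ContinuousOn (fun p : ℝ × ℝ => f p.1 p.2) S01 :=
    fun p hp => (F.D p hp).continuousWithinAt
  obtain ⟨B0, hB0, hB⟩ := bound_strip cf 0
  set R := B0 / c₀ ^ 2 with hR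
  have hvR : ∀ x ∈ Icc (0:ℝ) 1, |v x| ≤ R := by
    intro x hx
    refine (hv x hx).2.trans ?_
    have := hB x hx 0 (by simp)
    simp only at this
    rw [hR]; gcongr
  obtain ⟨B1, hB10, hB1⟩ := bound_strip F.cx R
  -- Lipschitz
  have hlip : ∀ x ∈ Icc (0:ℝ) 1, ∀ y ∈ Icc (0:ℝ) 1, |v x - v y| ≤ B1 / c₀ ^ 2 * |x - y| := by
    intro x hx y hy
    have e1 : c₀ ^ 2 * |v x - v y| ≤ |f x (v x) - f x (v y)| := by
      rcases le_total (v x) (v y) with h | h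
      · have := f_slope F hx h
        rw [abs_sub_comm, abs_of_nonneg (by linarith), abs_sub_comm]
        exact this.trans (le_abs_self _)
      · have := f_slope F hx h
        rw [abs_of_nonneg (by linarith)]
        exact this.trans (le_abs_self _)
    have e2 : |f x (v y) - f y (v y)| ≤ B1 * |x - y| := by
      have := Convex.norm_image_sub_le_of_norm_hasDerivWithin_le
        (f := fun t => f t (v y)) (f' := fun t => fx (t, v y)) (C := B1) (s := Icc (0:ℝ) 1)
        (x := y) (y := x) (fun t ht => ?_) (fun t ht => hB1 t ht _ (hvR y hy))
        (convex_Icc 0 1) hy hx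
      · exact this
      · have := chain_strip (F := fun p : ℝ × ℝ => f p.1 p.2) (g := fun _ => v y)
          (F.D (t, v y) (mem_S01 ht)) (hasDerivWithinAt_const t _ (v y))
        simpa using this
    rw [hv0 x hx] at e1
    rw [hv0 y hy, sub_zero] at e2
    rw [zero_sub, abs_neg] at e1
    rw [div_mul_eq_mul_div, le_div_iff₀ hc2]
    linarith
  have hcont : ContinuousOn v (Icc 0 1) := by
    have : LipschitzOnWith (Real.toNNReal (B1 / c₀ ^ 2)) v (Icc 0 1) := by
      apply LipschitzOnWith.of_dist_le_mul
      intro x hx y hy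
      rw [Real.coe_toNNReal _ (by positivity)]
      exact hlip x hx y hy
    exact this.continuousOn
  have hmap : MapsTo (fun x => (x, v x)) (Icc (0:ℝ) 1) S01 := fun x hx => mem_S01 hx
  have hpc : ContinuousOn (fun x => (x, v x)) (Icc (0:ℝ) 1) := continuousOn_id.prodMk hcont
  have fupos : ∀ x ∈ Icc (0:ℝ) 1, fu (x, v x) ≠ 0 := fun x hx =>
    (lt_of_lt_of_le hc2 (F.lower _ (mem_S01 hx))).ne'
  set v1 : ℝ → ℝ := fun x => -fx (x, v x) / fu (x, v x) with hv1
  have D0 : ∀ x ∈ Icc (0:ℝ) 1, HasDerivWithinAt v (v1 x) (Icc 0 1) x := by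
    intro x hx
    have h1 := (F.D (x, v x) (mem_S01 hx)).isLittleO
    have h2 : Filter.Tendsto (fun t => (t, v t)) (nhdsWithin x (Icc 0 1))
        (nhdsWithin (x, v x) S01) := (hpc x hx).tendsto_nhdsWithin hmap
    have h3 := h1.comp_tendsto h2
    have h4 : (fun t => (t, v t) - (x, v x)) =O[nhdsWithin x (Icc 0 1)] (fun t => t - x) := by
      refine Asymptotics.IsBigO.of_bound (max 1 (B1 / c₀ ^ 2)) ?_
      filter_upwards [self_mem_nhdsWithin] with t ht
      rw [Prod.mk_sub_mk, Prod.norm_mk]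
      refine max_le ?_ ?_
      · exact le_mul_of_one_le_left (norm_nonneg _) (le_max_left _ _)
      · refine (hlip t ht x hx).trans ?_
        rw [Real.norm_eq_abs]
        gcongr
        exact le_max_right _ _
    have h5 := h3.trans_isBigO h4
    rw [hasDerivWithinAt_iff_isLittleO]
    have h6 := h5.const_mul_left (-(fu (x, v x))⁻¹)
    refine h6.congr' ?_ Filter.EventuallyEq.rfl
    filter_upwards [self_mem_nhdsWithin] with t ht
    have := fupos x hx
    simp only [Function.comp, hv0 t ht, hv0 x hx, hv1]
    simp
    field_simp
    ring
  have cd : ∀ G : ℝ × ℝ → ℝ, ContinuousOn G S01 → ContinuousOn (fun x => G (x, v x)) (Icc 0 1) :=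
    fun G hG => hG.comp hpc hmap
  have cv1 : ContinuousOn v1 (Icc 0 1) := (cd fx F.cx).neg.div (cd fu F.cu) fupos
  set v2 : ℝ → ℝ := fun x => (-(fxx (x, v x) + fxu (x, v x) * v1 x) * fu (x, v x) -
    (-fx (x, v x)) * (fux (x, v x) + fuu (x, v x) * v1 x)) / fu (x, v x) ^ 2 with hv2
  have D1 : ∀ x ∈ Icc (0:ℝ) 1, HasDerivWithinAt v1 (v2 x) (Icc 0 1) x := by
    intro x hx
    have e1 := chain_strip (F.Dx (x, v x) (mem_S01 hx)) (D0 x hx)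
    have e2 := chain_strip (F.Du (x, v x) (mem_S01 hx)) (D0 x hx)
    exact e1.neg.div e2 (fupos x hx)
  have cv2 : ContinuousOn v2 (Icc 0 1) := by
    refine ContinuousOn.div ?_ ((cd fu F.cu).pow 2) (fun x hx => pow_ne_zero 2 (fupos x hx))
    exact ((((cd fxx F.cxx).add ((cd fxu F.cxu).mul cv1)).neg).mul (cd fu F.cu)).sub
      ((cd fx F.cx).neg.mul ((cd fux F.cux).add ((cd fuu F.cuu).mul cv1)))
  obtain ⟨M1, hM1⟩ := isCompact_Icc.exists_bound_of_continuousOn cv1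
  obtain ⟨M2, hM2⟩ := isCompact_Icc.exists_bound_of_continuousOn cv2
  have hR0 : 0 ≤ R := by positivity
  refine ⟨v, v1, v2, max R (max M1 M2), le_max_of_le_left hR0, hv0, D0, D1, ?_, ?_, ?_⟩
  · exact fun x hx => (hvR x hx).trans (le_max_left _ _)
  · exact fun x hx => (hM1 x hx).trans ((le_max_left _ _).trans (le_max_right _ _))
  · exact fun x hx => (hM2 x hx).trans ((le_max_right _ _).trans (le_max_right _ _))

theorem max_principle {g g1 g2 : ℝ → ℝ}
    (h0 : ∀ y ∈ Icc (0:ℝ) 1, HasDerivWithinAt g (g1 y) (Icc 0 1) y)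
    (h1 : ∀ y ∈ Icc (0:ℝ) 1, HasDerivWithinAt g1 (g2 y) (Icc 0 1) y)
    (b0 : 0 ≤ g 0) (b1 : 0 ≤ g 1)
    (hneg : ∀ x ∈ Ioo (0:ℝ) 1, g x < 0 → g2 x < 0) : ∀ x ∈ Icc (0:ℝ) 1, 0 ≤ g x := by
  have hc : ContinuousOn g (Icc 0 1) := fun y hy => (h0 y hy).continuousWithinAt
  obtain ⟨x₀, hx₀, hmin⟩ := isCompact_Icc.exists_isMinOn (nonempty_Icc.mpr zero_le_one) hc
  by_contra! hcon
  obtain ⟨z, hz, hzn⟩ := hcon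
  have hgx : g x₀ < 0 := lt_of_le_of_lt (hmin hz) hzn
  have hxo : x₀ ∈ Ioo (0:ℝ) 1 := by
    refine ⟨lt_of_le_of_ne hx₀.1 ?_, lt_of_le_of_ne hx₀.2 ?_⟩
    · rintro rfl; linarith
    · rintro rfl; linarith
  have hnh : ∀ x ∈ Ioo (0:ℝ) 1, Icc (0:ℝ) 1 ∈ nhds x := fun x hx => Icc_mem_nhds hx.1 hx.2
  have d0 : ∀ x ∈ Ioo (0:ℝ) 1, HasDerivAt g (g1 x) x := fun x hx =>
    (h0 x (Ioo_subset_Icc_self hx)).hasDerivAt (hnh x hx)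
  have d1 : HasDerivAt g1 (g2 x₀) x₀ := (h1 x₀ hx₀).hasDerivAt (hnh x₀ hxo)
  have hloc : IsLocalMin g x₀ := hmin.isLocalMin (hnh x₀ hxo)
  have hz1 : g1 x₀ = 0 := hloc.hasDerivAt_eq_zero (d0 x₀ hxo)
  have hlt := hneg x₀ hxo hgx
  rw [hasDerivAt_iff_tendsto_slope] at d1
  have hev := d1.eventually (gt_mem_nhds hlt)
  rw [eventually_nhdsWithin_iff, Metric.eventually_nhds_iff] at hev
  obtain ⟨δ, hδ, hev⟩ := hev
  set y := x₀ + min (δ / 2) ((1 - x₀) / 2) with hy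
  have hm0 : 0 < min (δ / 2) ((1 - x₀) / 2) := lt_min (by linarith) (by linarith [hxo.2])
  have hm1 := min_le_left (δ / 2) ((1 - x₀) / 2)
  have hm2 := min_le_right (δ / 2) ((1 - x₀) / 2)
  have hxy : x₀ < y := by linarith
  have hy1 : y < 1 := by linarith [hxo.2]
  obtain ⟨t, ht, hte⟩ := exists_hasDerivAt_eq_slope g g1 hxy
    (fun s hs => (d0 s ⟨hxo.1.trans_le hs.1, hs.2.trans_lt hy1⟩).continuousAt.continuousWithinAt)
    (fun s hs => d0 s ⟨hxo.1.trans hs.1, hs.2.trans hy1⟩)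
  have hs := hev (y := t) (by rw [Real.dist_eq, abs_of_pos (by linarith [ht.1])]; linarith [ht.2])
    (by simp; exact ht.1.ne')
  rw [slope_def_field, hz1, sub_zero] at hs
  have ht0 : g1 t < 0 := by
    by_contra! h
    exact absurd hs (not_lt.mpr (div_nonneg h (by linarith [ht.1])))
  rw [hte] at ht0
  have hyg : g x₀ ≤ g y := hmin ⟨by linarith [hxo.1], hy1.le⟩
  exact absurd ht0 (not_lt.mpr (div_nonneg (by linarith) (by linarith)))

/-- exponential part of `Pw` -/
def Ew (c₀ ε x : ℝ) : ℝ := Real.exp (-(c₀ / ε) * x) + Real.exp (-(c₀ / ε) * (1 - x))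

def Pw1 (c₀ ε x : ℝ) : ℝ :=
  -(c₀ / ε) * Real.exp (-(c₀ / ε) * x) + (c₀ / ε) * Real.exp (-(c₀ / ε) * (1 - x))

theorem Pw_eq (c₀ ε x : ℝ) : Pw c₀ ε x = ε ^ 2 + Ew c₀ ε x := rfl

theorem Ew_pos (c₀ ε x : ℝ) : 0 < Ew c₀ ε x := by unfold Ew; positivity

theorem Pw_ge (c₀ ε x : ℝ) : ε ^ 2 ≤ Pw c₀ ε x := by
  rw [Pw_eq]; linarith [Ew_pos c₀ ε x]

theorem Pw_pos' (c₀ ε x : ℝ) : 0 < Pw c₀ ε x := by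
  rw [Pw_eq]; linarith [Ew_pos c₀ ε x, sq_nonneg ε]

theorem Pw_le3 {c₀ ε x : ℝ} (hc₀ : 0 < c₀) (hε : ε ∈ Ioc (0:ℝ) 1) (hx : x ∈ Icc (0:ℝ) 1) :
    Pw c₀ ε x ≤ 3 := by
  have hp : 0 < c₀ / ε := div_pos hc₀ hε.1
  have h1 : Real.exp (-(c₀ / ε) * x) ≤ 1 := Real.exp_le_one_iff.mpr (by nlinarith [hx.1])
  have h2 : Real.exp (-(c₀ / ε) * (1 - x)) ≤ 1 := Real.exp_le_one_iff.mpr (by nlinarith [hx.2])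
  have h3 : ε ^ 2 ≤ 1 := pow_le_one₀ hε.1.le hε.2
  unfold Pw; linarith

theorem Pw_near {c₀ ε x y : ℝ} (hc₀ : 0 < c₀) (hε : 0 < ε) (hxy : |y - x| ≤ ε / 2) :
    Pw c₀ ε y ≤ Real.exp c₀ * Pw c₀ ε x := by
  obtain ⟨ha, hb⟩ := abs_le.mp hxy
  have hp : 0 < c₀ / ε := div_pos hc₀ hε
  have e1 : c₀ / ε * ε = c₀ := by field_simp
  have h1 : Real.exp (-(c₀ / ε) * y) ≤ Real.exp c₀ * Real.exp (-(c₀ / ε) * x) := by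
    rw [← Real.exp_add]; apply Real.exp_le_exp.mpr; nlinarith
  have h2 : Real.exp (-(c₀ / ε) * (1 - y)) ≤ Real.exp c₀ * Real.exp (-(c₀ / ε) * (1 - x)) := by
    rw [← Real.exp_add]; apply Real.exp_le_exp.mpr; nlinarith
  have h3 : 1 ≤ Real.exp c₀ := Real.one_le_exp hc₀.le
  have h4 : ε ^ 2 ≤ Real.exp c₀ * ε ^ 2 := le_mul_of_one_le_left (by positivity) h3
  unfold Pw; linarith

theorem hasDeriv_Pw (c₀ ε x : ℝ) : HasDerivAt (Pw c₀ ε) (Pw1 c₀ ε x) x := by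
  have h1 : HasDerivAt (fun x : ℝ => -(c₀ / ε) * x) (-(c₀ / ε) * 1) x :=
    (hasDerivAt_id x).const_mul _
  have h2 : HasDerivAt (fun x : ℝ => -(c₀ / ε) * (1 - x)) (-(c₀ / ε) * (-1)) x :=
    ((hasDerivAt_id x).const_sub 1).const_mul _
  have := (h1.exp.add h2.exp).const_add (ε ^ 2)
  refine this.congr_deriv ?_
  unfold Pw1; ring

theorem hasDeriv_Pw1 (c₀ ε x : ℝ) :
    HasDerivAt (Pw1 c₀ ε) ((c₀ / ε) ^ 2 * Ew c₀ ε x) x := by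
  have h1 : HasDerivAt (fun x : ℝ => -(c₀ / ε) * x) (-(c₀ / ε) * 1) x :=
    (hasDerivAt_id x).const_mul _
  have h2 : HasDerivAt (fun x : ℝ => -(c₀ / ε) * (1 - x)) (-(c₀ / ε) * (-1)) x :=
    ((hasDerivAt_id x).const_sub 1).const_mul _
  have := (h1.exp.const_mul (-(c₀ / ε))).add (h2.exp.const_mul (c₀ / ε))
  refine this.congr_deriv ?_
  unfold Ew; ring

/-- comparison with the barrier `K * Pw` -/
theorem barrier {c₀ ε M K : ℝ} (hε : 0 < ε) (hc₀ : 0 < c₀)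
    (hM : 0 ≤ M) (hKM : M ≤ K) (hK : M ≤ c₀ ^ 2 * K) {w w1 w2 v2 : ℝ → ℝ}
    (h0 : ∀ y ∈ Icc (0:ℝ) 1, HasDerivWithinAt w (w1 y) (Icc 0 1) y)
    (h1 : ∀ y ∈ Icc (0:ℝ) 1, HasDerivWithinAt w1 (w2 y) (Icc 0 1) y)
    (b0 : w 0 ≤ M) (b1 : w 1 ≤ M)
    (hv2 : ∀ x ∈ Icc (0:ℝ) 1, |v2 x| ≤ M)
    (hs : ∀ x ∈ Icc (0:ℝ) 1, 0 ≤ w x → c₀ ^ 2 * w x ≤ ε ^ 2 * (w2 x + v2 x)) :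
    ∀ x ∈ Icc (0:ℝ) 1, w x ≤ K * Pw c₀ ε x := by
  have hK0 : 0 ≤ K := hM.trans hKM
  have key : ∀ x ∈ Icc (0:ℝ) 1, 0 ≤ K * Pw c₀ ε x - w x := by
    refine max_principle (g := fun x => K * Pw c₀ ε x - w x)
      (g1 := fun x => K * Pw1 c₀ ε x - w1 x)
      (g2 := fun x => K * ((c₀ / ε) ^ 2 * Ew c₀ ε x) - w2 x) ?_ ?_ ?_ ?_ ?_
    · intro y hy
      exact ((hasDeriv_Pw c₀ ε y).hasDerivWithinAt.const_mul K).sub (h0 y hy)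
    · intro y hy
      exact ((hasDeriv_Pw1 c₀ ε y).hasDerivWithinAt.const_mul K).sub (h1 y hy)
    · have : 1 ≤ Pw c₀ ε 0 := by
        unfold Pw; simp; linarith [Real.exp_pos (-(c₀ / ε)), sq_nonneg ε]
      nlinarith
    · have : 1 ≤ Pw c₀ ε 1 := by
        unfold Pw; simp; linarith [Real.exp_pos (-(c₀ / ε)), sq_nonneg ε]
      nlinarith
    · intro x hx hg
      have hx' := Ioo_subset_Icc_self hx
      have hP := Pw_pos' c₀ ε x
      have hw : 0 ≤ w x := by have := mul_nonneg hK0 hP.le; linarith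
      have h2 := hs x hx' hw
      have h3 := (abs_le.mp (hv2 x hx')).2
      have hc2 : 0 < c₀ ^ 2 := by positivity
      have h4 : c₀ ^ 2 * (K * Pw c₀ ε x) < c₀ ^ 2 * w x := by
        apply mul_lt_mul_of_pos_left _ hc2; linarith
      rw [Pw_eq] at h4
      have hε2 : 0 < ε ^ 2 := by positivity
      have h5 : ε ^ 2 * v2 x ≤ ε ^ 2 * (c₀ ^ 2 * K) := by
        apply mul_le_mul_of_nonneg_left _ hε2.le; linarith
      have h6 : ε ^ 2 * (K * ((c₀ / ε) ^ 2 * Ew c₀ ε x) - w2 x) < 0 := by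
        have : ε ^ 2 * (K * ((c₀ / ε) ^ 2 * Ew c₀ ε x)) = c₀ ^ 2 * K * Ew c₀ ε x := by
          field_simp
        rw [mul_sub, this]; nlinarith
      exact (pos_iff_neg_of_mul_neg h6).mp hε2
  intro x hx
  linarith [key x hx]

theorem landau {g g1 g2 : ℝ → ℝ} {ε A B x : ℝ} (hε : ε ∈ Ioc (0:ℝ) 1)
    (h0 : ∀ y ∈ Icc (0:ℝ) 1, HasDerivWithinAt g (g1 y) (Icc 0 1) y)
    (h1 : ∀ y ∈ Icc (0:ℝ) 1, HasDerivWithinAt g1 (g2 y) (Icc 0 1) y)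
    (hx : x ∈ Icc (0:ℝ) 1)
    (hA : ∀ y ∈ Icc (0:ℝ) 1, |y - x| ≤ ε / 2 → |g y| ≤ A)
    (hB : ∀ y ∈ Icc (0:ℝ) 1, |y - x| ≤ ε / 2 → |g2 y| ≤ B) :
    |g1 x| ≤ 4 * A / ε + B * ε := by
  have hε0 := hε.1
  have hA0 : |g x| ≤ A := hA x hx (by simp; linarith)
  have hB0 : 0 ≤ B := (abs_nonneg _).trans (hB x hx (by simp; linarith))
  obtain ⟨c, d, y, hcx, hxd, hcy, hyd, hc, hd, hc', hd', hyx⟩ : ∃ c d y : ℝ,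
      c ≤ x ∧ x ≤ d ∧ c ≤ y ∧ y ≤ d ∧ 0 ≤ c ∧ d ≤ 1 ∧ x - ε / 2 ≤ c ∧ d ≤ x + ε / 2 ∧
      |y - x| = ε / 2 := by
    rcases le_total x (1 / 2) with h | h
    · refine ⟨x, x + ε / 2, x + ε / 2, le_rfl, by linarith, by linarith, le_rfl, hx.1, ?_, ?_, ?_, ?_⟩
      · linarith [hε.2]
      · linarith
      · linarith
      · rw [abs_of_nonneg] <;> linarith
    · refine ⟨x - ε / 2, x, x - ε / 2, by linarith, le_rfl, by linarith, by linarith, ?_, hx.2, ?_, ?_, ?_⟩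
      · linarith [hε.2]
      · linarith
      · linarith
      · rw [abs_of_nonpos] <;> linarith
  have hsub : Icc c d ⊆ Icc (0:ℝ) 1 := Icc_subset_Icc hc hd
  have hnear : ∀ y ∈ Icc c d, |y - x| ≤ ε / 2 := fun y hy => by
    rw [abs_le]; constructor <;> linarith [hy.1, hy.2]
  have ht := taylor2 hB0 (fun y hy => (h0 y (hsub hy)).mono hsub)
    (fun y hy => (h1 y (hsub hy)).mono hsub) (x := x) ⟨hcx, hxd⟩
    (fun y hy => hB y (hsub hy) (hnear y hy)) y ⟨hcy, hyd⟩
  have hAy := hA y (hsub ⟨hcy, hyd⟩) hyx.le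
  rw [hyx] at ht
  have h2 : |g1 x| * (ε / 2) ≤ A + A + B * (ε / 2) ^ 2 := by
    rw [← hyx, ← abs_mul, hyx]
    rw [abs_le] at *
    constructor <;> linarith [hAy.1, hAy.2, hA0.1, hA0.2, ht.1, ht.2]
  have h3 : |g1 x| * ε ≤ (4 * A / ε + B * ε) * ε := by
    have : (4 * A / ε + B * ε) * ε = 4 * A + B * ε ^ 2 := by field_simp
    rw [this]; nlinarith [mul_nonneg hB0 (sq_nonneg ε)]
  exact le_of_mul_le_mul_right h3 hε0


theorem aux_sq {ε s M K1 P : ℝ} (hε : 0 ≤ ε) (hs : 0 ≤ s) (hP0 : 0 ≤ P) (hP3 : P ≤ 3)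
    (hPe : ε ^ 2 ≤ P) (hse : ε * s ≤ ε * M + K1 * P) :
    ε ^ 2 * (1 + s) ^ 2 ≤ (2 * (1 + M) ^ 2 + 6 * K1 ^ 2) * P := by
  have h1 : ε * (1 + s) ≤ ε * (1 + M) + K1 * P := by linarith
  have h2 : (ε * (1 + s)) ^ 2 ≤ (ε * (1 + M) + K1 * P) ^ 2 :=
    pow_le_pow_left₀ (by positivity) h1 2
  have h3 : (ε * (1 + M) + K1 * P) ^ 2 ≤ 2 * (ε * (1 + M)) ^ 2 + 2 * (K1 * P) ^ 2 := by
    linarith [sq_nonneg (ε * (1 + M) - K1 * P)]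
  have h4 : ε ^ 2 * (1 + M) ^ 2 ≤ P * (1 + M) ^ 2 :=
    mul_le_mul_of_nonneg_right hPe (by positivity)
  have h5 : K1 ^ 2 * (P * P) ≤ K1 ^ 2 * (3 * P) :=
    mul_le_mul_of_nonneg_left (mul_le_mul_of_nonneg_right hP3 hP0) (by positivity)
  linarith

theorem aux_num {A1 A2 A3 A4 A5 t r B : ℝ} (c1 : |A1| ≤ B) (c2 : |A2| ≤ B) (c3 : |A3| ≤ B)
    (c4 : |A4| ≤ B) (c5 : |A5| ≤ B) :
    |(A1 + A2 * t) + ((A3 + A4 * t) * t + A5 * r)| ≤ B * (1 + |t|) ^ 2 + B * |r| := by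
  have hs0 := abs_nonneg t
  refine (abs_add_le _ _).trans ?_
  have i1 : |A1 + A2 * t| ≤ B + B * |t| := by
    refine (abs_add_le _ _).trans ?_
    rw [abs_mul]
    exact add_le_add c1 (mul_le_mul_of_nonneg_right c2 hs0)
  have i2 : |A3 + A4 * t| ≤ B + B * |t| := by
    refine (abs_add_le _ _).trans ?_
    rw [abs_mul]
    exact add_le_add c3 (mul_le_mul_of_nonneg_right c4 hs0)
  have i3 : |(A3 + A4 * t) * t + A5 * r| ≤ (B + B * |t|) * |t| + B * |r| := by
    refine (abs_add_le _ _).trans ?_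
    rw [abs_mul, abs_mul]
    exact add_le_add (mul_le_mul_of_nonneg_right i2 hs0)
      (mul_le_mul_of_nonneg_right c5 (abs_nonneg _))
  linarith

theorem f_lip {f : ℝ → ℝ → ℝ} {c₀ : ℝ} {fx fu fxx fxu fux fuu : ℝ × ℝ → ℝ}
    (F : FD f c₀ fx fu fxx fxu fux fuu) {R B x y z : ℝ} (hx : x ∈ Icc (0:ℝ) 1)
    (hB : ∀ y, |y| ≤ R → |fu (x, y)| ≤ B) (hy : |y| ≤ R) (hz : |z| ≤ R) :
    |f x z - f x y| ≤ B * |z - y| := by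
  have := Convex.norm_image_sub_le_of_norm_hasDerivWithin_le
    (f := fun t => f x t) (f' := fun t => fu (x, t)) (C := B) (s := Icc (-R) R)
    (x := y) (y := z)
    (fun t _ => (partial_strip hx (F.D (x, t) (mem_S01 hx))).hasDerivWithinAt)
    (fun t ht => hB t (abs_le.mpr ht)) (convex_Icc _ _) (abs_le.mp hy) (abs_le.mp hz)
  exact this

theorem sol_chain {f : ℝ → ℝ → ℝ} {c₀ ε : ℝ} {fx fu fxx fxu fux fuu : ℝ × ℝ → ℝ}
    (F : FD f c₀ fx fu fxx fxu fux fuu) (hε : 0 < ε) {u : ℝ → ℝ} (hu : IsSolution f ε u) :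
    ∃ u1 : ℝ → ℝ, (∀ x ∈ Icc (0:ℝ) 1, HasDerivWithinAt u (u1 x) (Icc 0 1) x) ∧
      (∀ x ∈ Icc (0:ℝ) 1, HasDerivWithinAt u1 (f x (u x) / ε ^ 2) (Icc 0 1) x) := by
  obtain ⟨hC, he, -, -⟩ := hu
  have hU : UniqueDiffOn ℝ (Icc (0:ℝ) 1) := uniqueDiffOn_Icc zero_lt_one
  have d0 : ∀ x ∈ Icc (0:ℝ) 1, HasDerivWithinAt u (derivWithin u (Icc 0 1) x) (Icc 0 1) x :=
    fun x hx => ((hC.differentiableOn (by norm_num)) x hx).hasDerivWithinAt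
  have h1 : ContDiffOn ℝ 3 (derivWithin u (Icc 0 1)) (Icc 0 1) :=
    hC.derivWithin hU (by norm_num)
  have h2 : ContDiffOn ℝ 2 (derivWithin (derivWithin u (Icc 0 1)) (Icc 0 1)) (Icc 0 1) :=
    h1.derivWithin hU (by norm_num)
  have d1 : ∀ x ∈ Icc (0:ℝ) 1, HasDerivWithinAt (derivWithin u (Icc 0 1))
      (derivWithin (derivWithin u (Icc 0 1)) (Icc 0 1) x) (Icc 0 1) x :=
    fun x hx => ((h1.differentiableOn (by norm_num)) x hx).hasDerivWithinAt
  have hcf : ContinuousOn (fun x => f x (u x) / ε ^ 2) (Icc 0 1) := by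
    intro x hx
    exact ((chain_strip (F := fun p : ℝ × ℝ => f p.1 p.2) (F.D (x, u x) (mem_S01 hx))
      (d0 x hx)).continuousWithinAt).div_const _
  have heq : EqOn (derivWithin (derivWithin u (Icc 0 1)) (Icc 0 1))
      (fun x => f x (u x) / ε ^ 2) (Ioo 0 1) := by
    intro x hx
    have := he x hx
    rw [iteratedDerivWithin_eq_iterate] at this
    simp only [Function.iterate_succ, Function.iterate_zero, Function.comp, id] at this
    show _ = f x (u x) / ε ^ 2
    rw [eq_div_iff (by positivity)]
    linarith
  have heq' : EqOn (derivWithin (derivWithin u (Icc 0 1)) (Icc 0 1))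
      (fun x => f x (u x) / ε ^ 2) (Icc 0 1) := by
    refine heq.of_subset_closure h2.continuousOn hcf Ioo_subset_Icc_self ?_
    rw [closure_Ioo (by norm_num)]
  refine ⟨derivWithin u (Icc 0 1), d0, fun x hx => ?_⟩
  have := d1 x hx
  rw [heq' hx] at this
  exact this

set_option maxHeartbeats 2000000 in
theorem layer_bounds {f : ℝ → ℝ → ℝ} {c₀ : ℝ} {fx fu fxx fxu fux fuu : ℝ × ℝ → ℝ}
    (F : FD f c₀ fx fu fxx fxu fux fuu) (hc₀ : 0 < c₀) :
    ∃ D R : ℝ, 0 ≤ D ∧ 0 ≤ R ∧ ∀ ε ∈ Ioc (0:ℝ) 1, ∀ u, IsSolution f ε u →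
      ∃ u1 u2 u3 u4 v v1 v2 : ℝ → ℝ, LayerBd c₀ ε D u u1 u2 u3 u4 v v1 v2 ∧
        (∀ x ∈ Icc (0:ℝ) 1, ε ^ 2 * u2 x = f x (u x)) ∧ (∀ x ∈ Icc (0:ℝ) 1, |u x| ≤ R) := by
  obtain ⟨v, v1, v2, M, hM, hv, e0, e1, hvM, hv1M, hv2M⟩ := reduced F hc₀
  have hc2 : 0 < c₀ ^ 2 := by positivity
  set K := M + M / c₀ ^ 2 with hK
  have hMc : 0 ≤ M / c₀ ^ 2 := by positivity
  have hK0 : 0 ≤ K := by positivity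
  have hKM : M ≤ K := by linarith
  have hKc : M ≤ c₀ ^ 2 * K := by
    have : c₀ ^ 2 * (M / c₀ ^ 2) = M := by field_simp
    rw [hK, mul_add, this]; linarith [mul_nonneg hc2.le hM]
  set R := M + 3 * K with hR
  have hR0 : 0 ≤ R := by positivity
  obtain ⟨B1, hB10, hB1⟩ := bound_strip F.cx R
  obtain ⟨B2, hB20, hB2⟩ := bound_strip F.cu R
  obtain ⟨B3, hB30, hB3⟩ := bound_strip F.cxx R
  obtain ⟨B4, hB40, hB4⟩ := bound_strip F.cxu R
  obtain ⟨B5, hB50, hB5⟩ := bound_strip F.cux R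
  obtain ⟨B6, hB60, hB6⟩ := bound_strip F.cuu R
  set B := B1 + B2 + B3 + B4 + B5 + B6 with hB
  have hB0 : 0 ≤ B := by positivity
  set G := Real.exp c₀ with hG
  have hG0 : 0 ≤ G := (Real.exp_pos _).le
  set K1 := (4 * K + B * K + M) * G with hK1
  have hK10 : 0 ≤ K1 := by positivity
  set K4 := B * (2 * (1 + M) ^ 2 + 6 * K1 ^ 2 + B * K) with hK4
  have hK40 : 0 ≤ K4 := by positivity
  set K3 := (4 * (B * K) + K4) * G with hK3
  have hK30 : 0 ≤ K3 := by positivity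
  have hBK : 0 ≤ B * K := by positivity
  refine ⟨M + K + B * K + K3 + K4, R, by positivity, hR0, fun ε hε u hu => ?_⟩
  obtain ⟨u1, d0, d1⟩ := sol_chain F hε.1 hu
  have hε0 := hε.1
  have hε2 : 0 < ε ^ 2 := by positivity
  obtain ⟨-, -, hu0, hu1⟩ := hu
  set u2 : ℝ → ℝ := fun x => f x (u x) / ε ^ 2 with hu2
  have hode : ∀ x, ε ^ 2 * u2 x = f x (u x) := fun x => by rw [hu2]; field_simp
  set u3 : ℝ → ℝ := fun x => (fx (x, u x) + fu (x, u x) * u1 x) / ε ^ 2 with hu3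
  set u4 : ℝ → ℝ := fun x => ((fxx (x, u x) + fxu (x, u x) * u1 x) +
    ((fux (x, u x) + fuu (x, u x) * u1 x) * u1 x + fu (x, u x) * u2 x)) / ε ^ 2 with hu4
  have d2 : ∀ x ∈ Icc (0:ℝ) 1, HasDerivWithinAt u2 (u3 x) (Icc 0 1) x := fun x hx =>
    (chain_strip (F := fun p : ℝ × ℝ => f p.1 p.2) (F.D (x, u x) (mem_S01 hx))
      (d0 x hx)).div_const _
  have d3 : ∀ x ∈ Icc (0:ℝ) 1, HasDerivWithinAt u3 (u4 x) (Icc 0 1) x := fun x hx =>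
    ((chain_strip (F.Dx (x, u x) (mem_S01 hx)) (d0 x hx)).add
      ((chain_strip (F.Du (x, u x) (mem_S01 hx)) (d0 x hx)).mul (d1 x hx))).div_const _
  have w0 : ∀ x ∈ Icc (0:ℝ) 1, |u x - v x| ≤ K * Pw c₀ ε x := by
    have z0 : (0:ℝ) ∈ Icc (0:ℝ) 1 := ⟨le_rfl, zero_le_one⟩
    have z1 : (1:ℝ) ∈ Icc (0:ℝ) 1 := ⟨zero_le_one, le_rfl⟩
    have a0 := abs_le.mp (hvM 0 z0)
    have a1 := abs_le.mp (hvM 1 z1)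
    intro x hx
    rw [abs_le']
    constructor
    · refine barrier (w := fun x => u x - v x) (w1 := fun x => u1 x - v1 x)
        (w2 := fun x => u2 x - v2 x) (v2 := v2) hε0 hc₀ hM hKM hKc
        (fun y hy => (d0 y hy).sub (e0 y hy)) (fun y hy => (d1 y hy).sub (e1 y hy))
        ?_ ?_ hv2M ?_ x hx
      · simp only [hu0]; linarith
      · simp only [hu1]; linarith
      · intro y hy hw
        have := f_slope F hy (show v y ≤ u y by linarith)
        rw [hv y hy, ← hode y] at this
        simp only [sub_add_cancel]; linarith
    · have := barrier (w := fun x => v x - u x) (w1 := fun x => v1 x - u1 x)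
        (w2 := fun x => v2 x - u2 x) (v2 := fun x => - v2 x) hε0 hc₀ hM hKM hKc
        (fun y hy => (e0 y hy).sub (d0 y hy)) (fun y hy => (e1 y hy).sub (d1 y hy))
        ?_ ?_ (fun y hy => by rw [abs_neg]; exact hv2M y hy) ?_ x hx
      · linarith
      · simp only [hu0]; linarith
      · simp only [hu1]; linarith
      · intro y hy hw
        have := f_slope F hy (show u y ≤ v y by linarith)
        rw [hv y hy, ← hode y] at this
        linarith
  have huR : ∀ x ∈ Icc (0:ℝ) 1, |u x| ≤ R := by
    intro x hx
    have h1 := abs_le.mp (w0 x hx)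
    have h2 := abs_le.mp (hvM x hx)
    have h3 : K * Pw c₀ ε x ≤ K * 3 := mul_le_mul_of_nonneg_left (Pw_le3 hc₀ hε hx) hK0
    rw [abs_le]; constructor <;> linarith
  have b2 : ∀ x ∈ Icc (0:ℝ) 1, |u2 x| ≤ B * K * Pw c₀ ε x / ε ^ 2 := by
    intro x hx
    have hl := f_lip F (R := R) (B := B) hx
      (fun y hy => (hB2 x hx y hy).trans (by rw [hB]; linarith))
      ((hvM x hx).trans (by linarith)) (huR x hx)
    rw [hv x hx, sub_zero] at hl
    rw [hu2, abs_div, abs_of_pos hε2]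
    apply div_le_div_of_nonneg_right _ hε2.le
    refine hl.trans ?_
    rw [mul_assoc]
    exact mul_le_mul_of_nonneg_left (w0 x hx) hB0
  have w1 : ∀ x ∈ Icc (0:ℝ) 1, |u1 x - v1 x| ≤ K1 * Pw c₀ ε x / ε := by
    intro x hx
    have := landau (A := K * (G * Pw c₀ ε x)) (B := (B * K + M) * (G * Pw c₀ ε x) / ε ^ 2)
      hε (fun y hy => (d0 y hy).sub (e0 y hy)) (fun y hy => (d1 y hy).sub (e1 y hy)) hx
      (fun y hy hyx => (w0 y hy).trans
        (mul_le_mul_of_nonneg_left (Pw_near hc₀ hε0 hyx) hK0))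
      (fun y hy hyx => ?_)
    · refine this.trans (le_of_eq ?_)
      rw [hK1]; field_simp
      try ring
    · have h1 := b2 y hy
      have h2 := hv2M y hy
      have h3 : M ≤ M * Pw c₀ ε y / ε ^ 2 := by
        rw [le_div_iff₀ hε2]
        exact mul_le_mul_of_nonneg_left (Pw_ge _ _ _) hM
      refine (abs_sub _ _).trans ?_
      have h4 : (B * K + M) * Pw c₀ ε y / ε ^ 2 ≤ (B * K + M) * (G * Pw c₀ ε x) / ε ^ 2 := by
        apply div_le_div_of_nonneg_right _ hε2.le
        exact mul_le_mul_of_nonneg_left (Pw_near hc₀ hε0 hyx) (by positivity)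
      rw [add_mul, add_div] at h4
      linarith
  have b4 : ∀ x ∈ Icc (0:ℝ) 1, |u4 x| ≤ K4 * Pw c₀ ε x / ε ^ 4 := by
    intro x hx
    set P := Pw c₀ ε x with hP
    have hP0 : 0 < P := Pw_pos' _ _ _
    have hP3 : P ≤ 3 := Pw_le3 hc₀ hε hx
    have hPe : ε ^ 2 ≤ P := Pw_ge _ _ _
    set s := |u1 x| with hs
    have hs0 : 0 ≤ s := abs_nonneg _
    have hse : ε * s ≤ ε * M + K1 * P := by
      have h1 := w1 x hx
      have h2 := hv1M x hx
      have h3 : s ≤ M + K1 * P / ε := by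
        have : u1 x = (u1 x - v1 x) + v1 x := by ring
        rw [hs, this]
        refine (abs_add_le _ _).trans ?_
        linarith
      have := mul_le_mul_of_nonneg_left h3 hε0.le
      have e : ε * (M + K1 * P / ε) = ε * M + K1 * P := by field_simp
      linarith
    have hsq : ε ^ 2 * (1 + s) ^ 2 ≤ (2 * (1 + M) ^ 2 + 6 * K1 ^ 2) * P :=
      aux_sq hε0.le hs0 hP0.le hP3 hPe hse
    have hr := huR x hx
    have c2 : |fu (x, u x)| ≤ B := (hB2 x hx _ hr).trans (by rw [hB]; linarith)
    have c3 : |fxx (x, u x)| ≤ B := (hB3 x hx _ hr).trans (by rw [hB]; linarith)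
    have c4 : |fxu (x, u x)| ≤ B := (hB4 x hx _ hr).trans (by rw [hB]; linarith)
    have c5 : |fux (x, u x)| ≤ B := (hB5 x hx _ hr).trans (by rw [hB]; linarith)
    have c6 : |fuu (x, u x)| ≤ B := (hB6 x hx _ hr).trans (by rw [hB]; linarith)
    have hnum : |(fxx (x, u x) + fxu (x, u x) * u1 x) +
        ((fux (x, u x) + fuu (x, u x) * u1 x) * u1 x + fu (x, u x) * u2 x)| ≤
        B * (1 + s) ^ 2 + B * |u2 x| := by
      exact aux_num c3 c4 c5 c6 c2
    have hb2 : ε ^ 2 * |u2 x| ≤ B * K * P := by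
      have := b2 x hx
      rw [le_div_iff₀ hε2] at this
      linarith
    rw [hu4, abs_div, abs_of_pos hε2, div_le_div_iff₀ hε2 (by positivity)]
    have h7 : ε ^ 2 * (B * (1 + s) ^ 2 + B * |u2 x|) ≤ K4 * P := by
      have j1 := mul_le_mul_of_nonneg_left hsq hB0
      have j2 := mul_le_mul_of_nonneg_left hb2 hB0
      have e : ε ^ 2 * (B * (1 + s) ^ 2 + B * |u2 x|) =
          B * (ε ^ 2 * (1 + s) ^ 2) + B * (ε ^ 2 * |u2 x|) := by ring
      have e' : K4 * P = B * ((2 * (1 + M) ^ 2 + 6 * K1 ^ 2) * P) + B * (B * K * P) := by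
        rw [hK4]; ring
      rw [e, e']; exact add_le_add j1 j2
    have h8 := mul_le_mul_of_nonneg_left hnum hε2.le
    have h9 := mul_le_mul_of_nonneg_right (h8.trans h7) hε2.le
    refine le_trans (le_of_eq ?_) h9
    ring
  have b3 : ∀ x ∈ Icc (0:ℝ) 1, |u3 x| ≤ K3 * Pw c₀ ε x / ε ^ 3 := by
    intro x hx
    have := landau (A := B * K * (G * Pw c₀ ε x) / ε ^ 2) (B := K4 * (G * Pw c₀ ε x) / ε ^ 4)
      hε d2 d3 hx
      (fun y hy hyx => (b2 y hy).trans ?_) (fun y hy hyx => (b4 y hy).trans ?_)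
    · refine this.trans (le_of_eq ?_)
      rw [hK3]; field_simp
      try ring
    · apply div_le_div_of_nonneg_right _ hε2.le
      exact mul_le_mul_of_nonneg_left (Pw_near hc₀ hε0 hyx) hBK
    · apply div_le_div_of_nonneg_right _ (by positivity)
      exact mul_le_mul_of_nonneg_left (Pw_near hc₀ hε0 hyx) hK40
  refine ⟨u1, u2, u3, u4, v, v1, v2, ⟨d0, d1, d2, d3, ?_, ?_, ?_, e0, e1, ?_, ?_⟩,
    fun x _ => hode x, huR⟩
  · intro x hx
    have := (Pw_pos' c₀ ε x).le
    refine (b2 x hx).trans ?_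
    gcongr; linarith
  · intro x hx
    have := (Pw_pos' c₀ ε x).le
    refine (b3 x hx).trans ?_
    gcongr; linarith
  · intro x hx
    have := (Pw_pos' c₀ ε x).le
    refine (b4 x hx).trans ?_
    gcongr; linarith
  · intro x hx
    refine (hv2M x hx).trans ?_
    linarith
  · intro x hx
    have := (Pw_pos' c₀ ε x).le
    refine (w0 x hx).trans ?_
    gcongr; linarith


theorem f_slope_p {f : ℝ → ℝ → ℝ} {c₀ : ℝ} {fx fu fxx fxu fux fuu : ℝ × ℝ → ℝ}
    (F : FD f c₀ fx fu fxx fxu fux fuu) {x : ℝ} (hx : x ∈ Icc (0:ℝ) 1) (y z : ℝ) :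
    ∃ p, c₀ ^ 2 ≤ p ∧ f x y - f x z = p * (y - z) := by
  rcases lt_trichotomy y z with h | h | h
  · have h1 := f_slope F hx h.le
    have h2 : 0 < z - y := by linarith
    refine ⟨(f x z - f x y) / (z - y), (le_div_iff₀ h2).mpr h1, ?_⟩
    field_simp
    ring
  · subst h
    exact ⟨c₀ ^ 2, le_rfl, by ring⟩
  · have h1 := f_slope F hx h.le
    have h2 : 0 < y - z := by linarith
    refine ⟨(f x y - f x z) / (y - z), (le_div_iff₀ h2).mpr h1, ?_⟩
    field_simp

theorem mesh_mem {a ε q α : ℝ} (hq : q ∈ Ioo (0:ℝ) (1/2)) (ha : 0 < a) (hε : 0 < ε)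
    (hα : IsBakhAlpha a ε q α) {n i : ℕ} (hn : 0 < n) (hi : i ≤ n) :
    bakhMesh a ε q α n i ∈ Icc (0:ℝ) 1 := by
  have hn' : (0:ℝ) < n := by exact_mod_cast hn
  have hi' : (i:ℝ) ≤ n := by exact_mod_cast hi
  exact lam_mem hq ha hε hα ⟨by positivity, (div_le_one hn').mpr hi'⟩

theorem mesh_zero {a ε q α : ℝ} (hq : q ∈ Ioo (0:ℝ) (1/2))
    (hα : IsBakhAlpha a ε q α) (n : ℕ) : bakhMesh a ε q α n 0 = 0 := by
  unfold bakhMesh; simp [lam_zero hq.1 hα]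

theorem mesh_last {a ε q α : ℝ} (hq : q ∈ Ioo (0:ℝ) (1/2))
    (hα : IsBakhAlpha a ε q α) {n : ℕ} (hn : 0 < n) : bakhMesh a ε q α n n = 1 := by
  have hn' : (0:ℝ) < n := by exact_mod_cast hn
  unfold bakhMesh; rw [div_self hn'.ne', lam_one hq hα]

theorem newton_rem {f : ℝ → ℝ → ℝ} {c₀ : ℝ} {fx fu fxx fxu fux fuu : ℝ × ℝ → ℝ}
    (F : FD f c₀ fx fu fxx fxu fux fuu) {x R T y z : ℝ} (hx : x ∈ Icc (0:ℝ) 1) (hT : 0 ≤ T)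
    (hb : ∀ y, |y| ≤ R → |fuu (x, y)| ≤ T) (hy : |y| ≤ R) (hz : |z| ≤ R) :
    |f x z - f x y - fu (x, y) * (z - y)| ≤ T * |z - y| ^ 2 :=
  taylor2 (g := fun t => f x t) (g1 := fun t => fu (x, t)) (g2 := fun t => fuu (x, t))
    (c := -R) (d := R) hT
    (fun t _ => (partial_strip hx (F.D (x, t) (mem_S01 hx))).hasDerivWithinAt)
    (fun t _ => (partial_strip hx (F.Du (x, t) (mem_S01 hx))).hasDerivWithinAt)
    (abs_le.mp hy) (fun t ht => hb t (abs_le.mpr ht)) z (abs_le.mp hz)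

theorem Ct_nonneg {a q D : ℝ} (ha : 0 < a) (hD : 0 ≤ D) : 0 ≤ Ct a q D := by
  have := Kp_nonneg a q
  unfold Ct; positivity

theorem Ci_nonneg {a q D : ℝ} (hD : 0 ≤ D) : 0 ≤ Ci a q D := by
  have := Kp_nonneg a q
  unfold Ci; positivity

theorem coarse_err {f : ℝ → ℝ → ℝ} {c₀ : ℝ} {fx fu fxx fxu fux fuu : ℝ × ℝ → ℝ}
    (F : FD f c₀ fx fu fxx fxu fux fuu) (hc₀ : 0 < c₀)
    {a ε q α D : ℝ} (hq : q ∈ Ioo (0:ℝ) (1/2)) (ha : 0 < a) (hε : 0 < ε)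
    (hac : 2 ≤ a * c₀) (hα : IsBakhAlpha a ε q α) (hD : 0 ≤ D)
    {u u1 u2 u3 u4 v v1 v2 : ℝ → ℝ} (L : LayerBd c₀ ε D u u1 u2 u3 u4 v v1 v2)
    (hode : ∀ x ∈ Icc (0:ℝ) 1, ε ^ 2 * u2 x = f x (u x)) (hu0 : u 0 = 0) (hu1 : u 1 = 0)
    {n : ℕ} (hn : 0 < n) {y : ℕ → ℝ} (hy : NonlinScheme f ε (bakhMesh a ε q α n) n y) :
    ∀ i ≤ n, |y i - u (bakhMesh a ε q α n i)| ≤ Ct a q D * ((n:ℝ) ^ 2)⁻¹ / c₀ ^ 2 := by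
  have hex : ∀ i : ℕ, ∃ p, i ≤ n → c₀ ^ 2 ≤ p ∧
      f (bakhMesh a ε q α n i) (y i) - f (bakhMesh a ε q α n i) (u (bakhMesh a ε q α n i))
        = p * (y i - u (bakhMesh a ε q α n i)) := by
    intro i
    by_cases h : i ≤ n
    · obtain ⟨p, hp⟩ := f_slope_p F (mesh_mem hq ha hε hα hn h) (y i)
        (u (bakhMesh a ε q α n i))
      exact ⟨p, fun _ => hp⟩
    · exact ⟨0, fun h' => absurd h' h⟩
  choose p hp using hex
  refine disc_stab (z := fun i => y i - u (bakhMesh a ε q α n i)) (ε := ε) (by positivity)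
    (mul_nonneg (Ct_nonneg ha hD) (by positivity)) (mesh_strictMono hq ha hε hα hn) p
    (fun i => ε ^ 2 * (ddiff (bakhMesh a ε q α n) (fun j => u (bakhMesh a ε q α n j)) i
      - u2 (bakhMesh a ε q α n i)))
    (fun i _ h2 => (hp i h2.le).1) (fun i h1 h2 => trunc hq ha hε hc₀ hac hα hD L h1 h2) ?_ ?_ ?_
  · intro i h1 h2
    rw [ddiff_sub, ← (hp i h2.le).2]
    have e1 := hy.1 i h1 h2
    have e2 := hode _ (mesh_mem hq ha hε hα hn h2.le)
    linarith
  · simp only [mesh_zero hq hα, hu0, hy.2.1, sub_zero]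
  · simp only [mesh_last hq hα hn, hu1, hy.2.2, sub_zero]

theorem fine_err {f : ℝ → ℝ → ℝ} {c₀ : ℝ} {fx fu fxx fxu fux fuu : ℝ × ℝ → ℝ}
    (F : FD f c₀ fx fu fxx fxu fux fuu) (hc₀ : 0 < c₀)
    {a ε q α D R T δ : ℝ} (hq : q ∈ Ioo (0:ℝ) (1/2)) (ha : 0 < a) (hε : 0 < ε)
    (hac : 2 ≤ a * c₀) (hα : IsBakhAlpha a ε q α) (hD : 0 ≤ D)
    {u u1 u2 u3 u4 v v1 v2 : ℝ → ℝ} (L : LayerBd c₀ ε D u u1 u2 u3 u4 v v1 v2)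
    (hode : ∀ x ∈ Icc (0:ℝ) 1, ε ^ 2 * u2 x = f x (u x)) (hu0 : u 0 = 0) (hu1 : u 1 = 0)
    (hT : 0 ≤ T) (hb : ∀ x ∈ Icc (0:ℝ) 1, ∀ y, |y| ≤ R → |fuu (x, y)| ≤ T)
    {w : ℝ → ℝ} (hw : ∀ x ∈ Icc (0:ℝ) 1, |w x| ≤ R) (huR : ∀ x ∈ Icc (0:ℝ) 1, |u x| ≤ R)
    (hδ : ∀ x ∈ Icc (0:ℝ) 1, |w x - u x| ≤ δ)
    {n : ℕ} (hn : 0 < n) {y : ℕ → ℝ}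
    (hy : LinScheme (fun t => pderiv1 f t (w t))
      (fun t => pderiv1 f t (w t) * w t - f t (w t)) ε (bakhMesh a ε q α n) n y) :
    ∀ i ≤ n, |y i - u (bakhMesh a ε q α n i)| ≤
      (Ct a q D * ((n:ℝ) ^ 2)⁻¹ + T * δ ^ 2) / c₀ ^ 2 := by
  set x := bakhMesh a ε q α n with hx
  have hm : ∀ i ≤ n, x i ∈ Icc (0:ℝ) 1 := fun i hi => mesh_mem hq ha hε hα hn hi
  refine disc_stab (z := fun i => y i - u (x i)) (ε := ε) (by positivity)
    (add_nonneg (mul_nonneg (Ct_nonneg ha hD) (by positivity)) (by positivity))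
    (mesh_strictMono hq ha hε hα hn) (fun i => fu (x i, w (x i)))
    (fun i => ε ^ 2 * (ddiff x (fun j => u (x j)) i - u2 (x i)) +
      (f (x i) (u (x i)) - f (x i) (w (x i)) - fu (x i, w (x i)) * (u (x i) - w (x i))))
    (fun i _ h2 => F.lower _ (mem_S01 (hm i h2.le))) (fun i h1 h2 => ?_) ?_ ?_ ?_
  · refine (abs_add_le _ _).trans (add_le_add (trunc hq ha hε hc₀ hac hα hD L h1 h2) ?_)
    have hi := hm i h2.le
    refine (newton_rem F hi hT (hb _ hi) (hw _ hi) (huR _ hi)).trans ?_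
    have := hδ _ hi
    rw [abs_sub_comm] at this
    exact mul_le_mul_of_nonneg_left (pow_le_pow_left₀ (abs_nonneg _) this 2) hT
  · intro i h1 h2
    have hi := hm i h2.le
    rw [ddiff_sub]
    have e1 := hy.1 i h1 h2
    simp only [F.pd _ hi] at e1
    have e2 := hode _ hi
    linarith
  · simp only [hx, mesh_zero hq hα, hu0, hy.2.1, sub_zero]
  · simp only [hx, mesh_last hq hα hn, hu1, hy.2.2, sub_zero]


/-- error estimate of the two-grid algorithm on the Bakhvalov
mesh, with fine mesh `n = N²`. -/
theorem stmt_18 (f : ℝ → ℝ → ℝ) (c₀ : ℝ) (hc₀ : 0 < c₀)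
    (hf : SmoothF f) (hfu : LowerF f c₀)
    (q a : ℝ) (hq : q ∈ Ioo (0:ℝ) (1/2)) (ha : 0 < a)
    (hac : 2 ≤ a * c₀) :
    ∃ N₀ : ℕ, ∃ C : ℝ, 0 < C ∧
      ∀ ε ∈ Ioc (0:ℝ) 1, a * ε < q → ∀ N : ℕ, N₀ ≤ N →
      ∀ α : ℝ, IsBakhAlpha a ε q α →
      ∀ u : ℝ → ℝ, IsSolution f ε u →
      ∀ yH : ℕ → ℝ, NonlinScheme f ε (bakhMesh a ε q α N) N yH →
      ∀ yint : ℝ → ℝ, IsLinInterp (bakhMesh a ε q α N) N yH yint →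
      ∀ yh : ℕ → ℝ,
        LinScheme (fun t => pderiv1 f t (yint t))
          (fun t => pderiv1 f t (yint t) * yint t - f t (yint t)) ε
          (bakhMesh a ε q α (N ^ 2)) (N ^ 2) yh →
      ∀ uI : ℝ → ℝ,
        IsLinInterp (bakhMesh a ε q α (N ^ 2)) (N ^ 2) yh uI →
        ∀ x ∈ Icc (0:ℝ) 1,
          |uI x - u x| ≤ C * ((N:ℝ) ^ 4)⁻¹ := by
  obtain ⟨fx, fu, fxx, fxu, fux, fuu, F⟩ := exists_FD hf hfu
  obtain ⟨D, R, hD, hR, hL⟩ := layer_bounds F hc₀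
  have hc2 : 0 < c₀ ^ 2 := by positivity
  have ht0 : 0 ≤ Ct a q D := Ct_nonneg ha hD
  have hi0 : 0 ≤ Ci a q D := Ci_nonneg hD
  set C1 := Ct a q D / c₀ ^ 2 + Ci a q D with hC1
  have hC10 : 0 ≤ C1 := by positivity
  obtain ⟨T, hT, hb⟩ := bound_strip F.cuu (R + C1)
  refine ⟨1, (Ct a q D + T * C1 ^ 2) / c₀ ^ 2 + Ci a q D + 1, by positivity, ?_⟩
  intro ε hε haε N hN α hα u hu yH hyH yint hyint yh hyh uI huI
  obtain ⟨u1, u2, u3, u4, v, v1, v2, L, hode, huR⟩ := hL ε hε u hu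
  obtain ⟨-, -, hu0, hu1⟩ := hu
  have hN0 : 0 < N := hN
  have hN' : (1:ℝ) ≤ N := by exact_mod_cast hN
  have hn : 0 < N ^ 2 := by positivity
  have hcast : (((N ^ 2 : ℕ) : ℝ) ^ 2)⁻¹ = ((N:ℝ) ^ 4)⁻¹ := by push_cast; ring_nf
  have h1 := coarse_err F hc₀ hq ha hε.1 hac hα hD L hode hu0 hu1 hN0 hyH
  have h2 := mesh_interp hq ha hε.1 hc₀ hac hα hD L hN0 hyint h1
  have h3 : ∀ x ∈ Icc (0:ℝ) 1, |yint x - u x| ≤ C1 * ((N:ℝ) ^ 2)⁻¹ := by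
    intro x hx
    refine (h2 x hx).trans (le_of_eq ?_)
    rw [hC1]; ring
  have h4 : ((N:ℝ) ^ 2)⁻¹ ≤ 1 := inv_le_one_of_one_le₀ (one_le_pow₀ hN')
  have h5 : ∀ x ∈ Icc (0:ℝ) 1, |yint x| ≤ R + C1 := by
    intro x hx
    have a1 := abs_le.mp ((h3 x hx).trans (mul_le_of_le_one_right hC10 h4))
    have a2 := abs_le.mp (huR x hx)
    rw [abs_le]; constructor <;> linarith
  have h6 := fine_err F hc₀ hq ha hε.1 hac hα hD L hode hu0 hu1 hT hb h5
    (fun x hx => (huR x hx).trans (by linarith)) h3 hn hyh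
  intro x hx
  have h7 := mesh_interp hq ha hε.1 hc₀ hac hα hD L hn huI h6 x hx
  rw [hcast] at h7
  refine h7.trans ?_
  have e : (C1 * ((N:ℝ) ^ 2)⁻¹) ^ 2 = C1 ^ 2 * ((N:ℝ) ^ 4)⁻¹ := by
    rw [mul_pow, inv_pow]; ring_nf
  rw [e]
  have hp : 0 ≤ ((N:ℝ) ^ 4)⁻¹ := by positivity
  have e2 : (Ct a q D * ((N:ℝ) ^ 4)⁻¹ + T * (C1 ^ 2 * ((N:ℝ) ^ 4)⁻¹)) / c₀ ^ 2 =
    (Ct a q D + T * C1 ^ 2) / c₀ ^ 2 * ((N:ℝ) ^ 4)⁻¹ := by ring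
  rw [e2]
  linarith
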